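/- arXiv:1307.6333 — 5 statements merged into one kernel-verified Lean document; each statement's English description precedes it below -/
import Mathlib

section
/- A specification ψ of the logic of knowledge and branching time for a single agent is realizable in a finite interpreted environment E if and only if there exists an acceptable labelled tree for ψ and E. -/
/-! Single-agent framework: formulas of the logic of knowledge and branching time,
finite interpreted environments, runs, protocols, generated interpreted systems,
satisfaction, realizability, labelled trees and acceptability. -/

/-- Formulae of the logic of knowledge and (branching/linear) time for a single agent:
atomic propositions, ¬, ∧, ○ (next), U (until), ∃ (branching quantifier), K₁. -/
inductive Fml (PP : Type) : Type
  | tru : Fml PP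
  | atom : PP → Fml PP
  | neg : Fml PP → Fml PP
  | conj : Fml PP → Fml PP → Fml PP
  | next : Fml PP → Fml PP
  | untl : Fml PP → Fml PP → Fml PP
  | exis : Fml PP → Fml PP
  | know : Fml PP → Fml PP

namespace Fml
variable {PP : Type}

/-- The list of subformulae of a formula. -/
def subf : Fml PP → List (Fml PP)
  | tru => [tru]
  | atom p => [atom p]
  | neg φ => neg φ :: φ.subf
  | conj φ ψ => conj φ ψ :: (φ.subf ++ ψ.subf)
  | next φ => next φ :: φ.subf
  | untl φ ψ => untl φ ψ :: (φ.subf ++ ψ.subf)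
  | exis φ => exis φ :: φ.subf
  | know φ => know φ :: φ.subf

/-- The size of a formula. -/
def size : Fml PP → ℕ
  | tru => 1
  | atom _ => 1
  | neg φ => φ.size + 1
  | conj φ ψ => φ.size + ψ.size + 1
  | next φ => φ.size + 1
  | untl φ ψ => φ.size + ψ.size + 1
  | exis φ => φ.size + 1
  | know φ => φ.size + 1

end Fml

/-- A (finite, when the state type is finite) interpreted environment for a single agent:
initial states, protocol of the environment (nonempty sets of environment actions),
transition function indexed by joint actions, observation function, interpretation. -/
structure Env (S ACTe ACT1 O PP : Type) where
  initSt : Set S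
  Pe : S → Set ACTe
  Pe_ne : ∀ s, (Pe s).Nonempty
  tr : ACTe × ACT1 → S → S
  obs : S → O
  val : S → PP → Bool

namespace Env
variable {S ACTe ACT1 O PP : Type}

/-- Synchronous perfect-recall local state `r₁(m) = O₁(r 0) … O₁(r m)`. -/
def locSt (E : Env S ACTe ACT1 O PP) (r : ℕ → S) (m : ℕ) : List O :=
  (List.range (m + 1)).map fun k => E.obs (r k)

/-- The runs of the interpreted system ℐ(P,E) generated by protocol `P` in `E`:
every transition is by a joint action allowed by the environment's protocol and by `P`
at the current local state. -/
def IsRun (E : Env S ACTe ACT1 O PP) (P : List O → Set ACT1) (r : ℕ → S) : Prop :=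
  r 0 ∈ E.initSt ∧ ∀ m, ∃ a : ACTe × ACT1,
    a.1 ∈ E.Pe (r m) ∧ a.2 ∈ P (E.locSt r m) ∧ r (m + 1) = E.tr a (r m)

/-- Satisfaction `ℐ(P,E),(r,m) ⊨ φ`. -/
def sat (E : Env S ACTe ACT1 O PP) (P : List O → Set ACT1) :
    (ℕ → S) → ℕ → Fml PP → Prop
  | _, _, .tru => True
  | r, m, .atom p => E.val (r m) p = true
  | r, m, .neg φ => ¬ E.sat P r m φ
  | r, m, .conj φ ψ => E.sat P r m φ ∧ E.sat P r m ψ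
  | r, m, .next φ => E.sat P r (m + 1) φ
  | r, m, .untl φ ψ => ∃ k, m ≤ k ∧ E.sat P r k ψ ∧ ∀ l, m ≤ l → l < k → E.sat P r l φ
  | r, m, .exis φ => ∃ r', E.IsRun P r' ∧ (∀ k, k ≤ m → r' k = r k) ∧ E.sat P r' m φ
  | r, m, .know φ => ∀ r' m', E.IsRun P r' → E.locSt r' m' = E.locSt r m → E.sat P r' m' φ

/-- `P` realizes `ψ` in `E`: `ψ` holds at time 0 of every run of ℐ(P,E). -/
def Realizes (E : Env S ACTe ACT1 O PP) (P : List O → Set ACT1) (ψ : Fml PP) : Prop :=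
  ∀ r, E.IsRun P r → E.sat P r 0 ψ

/-- `ψ` is realizable in `E`: some protocol (with nonempty action sets) realizes it. -/
def Realizable (E : Env S ACTe ACT1 O PP) (ψ : Fml PP) : Prop :=
  ∃ P : List O → Set ACT1, (∀ v, (P v).Nonempty) ∧ E.Realizes P ψ

end Env

/-- A label: a knowledge set (a set of pairs of an atom -- a Boolean valuation of formulae --
and a state) together with a set of agent-1 actions. -/
abbrev KLabel (S ACT1 PP : Type) : Type := Set ((Fml PP → Bool) × S) × Set ACT1

/-- A labelled tree for ψ and E: a labelling of 𝒪* by labels. -/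
abbrev LTree (S ACT1 O PP : Type) : Type := List O → KLabel S ACT1 PP

namespace Env
variable {S ACTe ACT1 O PP : Type}

/-- The branch of vertices determined by starting vertex `v` and state sequence `r`:
`v₀ = v`, `v_{m+1} = v_m · O₁(r (m+1))`. -/
def vtx (E : Env S ACTe ACT1 O PP) (v : List O) (r : ℕ → S) : ℕ → List O
  | 0 => v
  | m + 1 => E.vtx v r m ++ [E.obs (r (m + 1))]

/-- A run of the labelled tree `T` from vertex `v`. -/
def IsTreeRun (E : Env S ACTe ACT1 O PP) (T : LTree S ACT1 O PP) (v : List O)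
    (r : ℕ → S) : Prop :=
  (∃ X, (X, r 0) ∈ (T v).1) ∧ ∀ m, ∃ a : ACTe × ACT1,
    a.1 ∈ E.Pe (r m) ∧ a.2 ∈ (T (E.vtx v r m)).2 ∧ r (m + 1) = E.tr a (r m)

/-- The relation `𝒯,v,(r,m) ⊨* φ`. -/
def tsat (E : Env S ACTe ACT1 O PP) (T : LTree S ACT1 O PP) (v : List O) :
    (ℕ → S) → ℕ → Fml PP → Prop
  | _, _, .tru => True
  | r, m, .atom p => E.val (r m) p = true
  | r, m, .neg φ => ¬ E.tsat T v r m φ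
  | r, m, .conj φ ψ => E.tsat T v r m φ ∧ E.tsat T v r m ψ
  | r, m, .next φ => E.tsat T v r (m + 1) φ
  | r, m, .untl φ ψ => ∃ k, m ≤ k ∧ E.tsat T v r k ψ ∧ ∀ l, m ≤ l → l < k → E.tsat T v r l φ
  | r, m, .exis φ => ∃ X : Fml PP → Bool, (X, r m) ∈ (T (E.vtx v r m)).1 ∧ X φ = true
  | r, m, .know φ => ∀ X s, (X, s) ∈ (T (E.vtx v r m)).1 → X φ = true

/-- Acceptability of a labelled tree for ψ and E: the conditions Real, Init, Obs, Pred,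
Succ, ∃sound, ∃comp, Ksound, Kcomp (plus nonemptiness of the action labels, part of
being a labelled tree). -/
structure Acceptable (E : Env S ACTe ACT1 O PP) (ψ : Fml PP) (T : LTree S ACT1 O PP) :
    Prop where
  actNe : ∀ v, (T v).2.Nonempty
  real : ∀ (o : O) X s, (X, s) ∈ (T [o]).1 → X ψ = true ∧ s ∈ E.initSt
  initC : ∀ s ∈ E.initSt, ∃ X, (X, s) ∈ (T [E.obs s]).1
  obsC : ∀ (v : List O) (o : O) X s, (X, s) ∈ (T (v ++ [o])).1 → E.obs s = o
  pred : ∀ (v : List O) (o : O) X s, v ≠ [] → (X, s) ∈ (T (v ++ [o])).1 →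
    ∃ Y t, ∃ a : ACTe × ACT1, (Y, t) ∈ (T v).1 ∧ a.1 ∈ E.Pe t ∧ a.2 ∈ (T v).2 ∧ s = E.tr a t
  succ : ∀ (v : List O) X s, ∀ a : ACTe × ACT1, v ≠ [] → (X, s) ∈ (T v).1 →
    a.1 ∈ E.Pe s → a.2 ∈ (T v).2 →
    ∃ Y, (Y, E.tr a s) ∈ (T (v ++ [E.obs (E.tr a s)])).1
  exSound : ∀ (v : List O) X s φ, (Fml.exis φ) ∈ ψ.subf → (X, s) ∈ (T v).1 →
    X (Fml.exis φ) = true → ∃ Y, (Y, s) ∈ (T v).1 ∧ Y φ = true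
  exComp : ∀ (v : List O) X Y s φ, (Fml.exis φ) ∈ ψ.subf → (X, s) ∈ (T v).1 →
    (Y, s) ∈ (T v).1 → X φ = true → Y (Fml.exis φ) = true
  ksound : ∀ (v : List O) X s, v ≠ [] → (X, s) ∈ (T v).1 →
    ∃ r, E.IsTreeRun T v r ∧ r 0 = s ∧ ∀ φ ∈ ψ.subf, (E.tsat T v r 0 φ ↔ X φ = true)
  kcomp : ∀ (v : List O) r, E.IsTreeRun T v r →
    ∃ X, (X, r 0) ∈ (T v).1 ∧ ∀ φ ∈ ψ.subf, (E.tsat T v r 0 φ ↔ X φ = true)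

end Env

namespace Env
variable {S ACTe ACT1 O PP : Type}

/-- `r` follows protocol `P` starting from vertex `v`. -/
def Follows (E : Env S ACTe ACT1 O PP) (P : List O → Set ACT1) (v : List O) (r : ℕ → S) : Prop :=
  ∀ m, ∃ a : ACTe × ACT1,
    a.1 ∈ E.Pe (r m) ∧ a.2 ∈ P (E.vtx v r m) ∧ r (m + 1) = E.tr a (r m)

/-- Splice a prefix with a continuation. -/
def splice (r : ℕ → S) (m : ℕ) (r1 : ℕ → S) : ℕ → S :=
  fun k => if k ≤ m then r k else r1 (k - m)

theorem splice_le (r : ℕ → S) (m : ℕ) (r1 : ℕ → S) {k : ℕ} (h : k ≤ m) :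
    splice r m r1 k = r k := by simp [splice, h]

theorem splice_add (r : ℕ → S) (m : ℕ) (r1 : ℕ → S) (h : r1 0 = r m) (j : ℕ) :
    splice r m r1 (m + j) = r1 j := by
  rcases j with _ | j
  · simp [splice, h]
  · simp [splice]

theorem locSt_zero (E : Env S ACTe ACT1 O PP) (r : ℕ → S) : E.locSt r 0 = [E.obs (r 0)] := by
  simp [locSt]

theorem locSt_succ (E : Env S ACTe ACT1 O PP) (r : ℕ → S) (m : ℕ) :
    E.locSt r (m + 1) = E.locSt r m ++ [E.obs (r (m + 1))] := by
  simp [locSt, List.range_succ]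

theorem locSt_length (E : Env S ACTe ACT1 O PP) (r : ℕ → S) (m : ℕ) :
    (E.locSt r m).length = m + 1 := by
  simp [locSt]

theorem locSt_ne (E : Env S ACTe ACT1 O PP) (r : ℕ → S) (m : ℕ) : E.locSt r m ≠ [] := by
  intro h
  have := E.locSt_length r m
  simp [h] at this

theorem locSt_inj (E : Env S ACTe ACT1 O PP) {r r' : ℕ → S} {m m' : ℕ}
    (h : E.locSt r m = E.locSt r' m') : m = m' := by
  have h1 := E.locSt_length r m
  have h2 := E.locSt_length r' m'
  rw [h] at h1
  omega

theorem locSt_congr (E : Env S ACTe ACT1 O PP) {r r' : ℕ → S} {m : ℕ}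
    (h : ∀ k, k ≤ m → r' k = r k) : E.locSt r' m = E.locSt r m := by
  unfold locSt
  apply List.map_congr_left
  intro k hk
  rw [h k (by simp at hk; omega)]

theorem vtx_locSt (E : Env S ACTe ACT1 O PP) (r r1 : ℕ → S) (m : ℕ)
    (h : ∀ j, r (m + j) = r1 j) (j : ℕ) :
    E.vtx (E.locSt r m) r1 j = E.locSt r (m + j) := by
  induction j with
  | zero => rfl
  | succ j ih => rw [vtx, ih, ← h, ← Nat.add_assoc, locSt_succ]

theorem vtx_obs (E : Env S ACTe ACT1 O PP) (r : ℕ → S) (m : ℕ) :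
    E.vtx [E.obs (r 0)] r m = E.locSt r m := by
  have := E.vtx_locSt r r 0 (by simp) m
  rwa [locSt_zero, Nat.zero_add] at this

theorem IsRun.follows {E : Env S ACTe ACT1 O PP} {P : List O → Set ACT1} {r : ℕ → S}
    (hr : E.IsRun P r) (m : ℕ) : E.Follows P (E.locSt r m) (fun j => r (m + j)) := by
  intro j
  obtain ⟨a, h1, h2, h3⟩ := hr.2 (m + j)
  refine ⟨a, h1, ?_, h3⟩
  rwa [vtx_locSt E r _ m (fun _ => rfl)]

theorem locSt_splice (E : Env S ACTe ACT1 O PP) (r : ℕ → S) (m : ℕ) (r1 : ℕ → S)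
    {k : ℕ} (h : k ≤ m) : E.locSt (splice r m r1) k = E.locSt r k :=
  E.locSt_congr fun j hj => splice_le r m r1 (hj.trans h)

theorem IsRun.splice {E : Env S ACTe ACT1 O PP} {P : List O → Set ACT1} {r : ℕ → S}
    (hr : E.IsRun P r) (m : ℕ) {r1 : ℕ → S} (h0 : r1 0 = r m)
    (h1 : E.Follows P (E.locSt r m) r1) : E.IsRun P (splice r m r1) := by
  constructor
  · rw [splice_le r m r1 (Nat.zero_le _)]; exact hr.1
  · intro k
    by_cases hk : k < m
    · obtain ⟨a, ha⟩ := hr.2 k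
      refine ⟨a, ?_⟩
      rw [splice_le r m r1 hk.le, splice_le r m r1 (Nat.succ_le_of_lt hk),
        locSt_splice E r m r1 hk.le]
      exact ha
    · obtain ⟨j, rfl⟩ := Nat.exists_eq_add_of_le (not_lt.mp hk)
      obtain ⟨a, ha1, ha2, ha3⟩ := h1 j
      refine ⟨a, ?_⟩
      rw [Nat.add_assoc, splice_add r m r1 h0, splice_add r m r1 h0,
        ← vtx_locSt E _ r1 m (splice_add r m r1 h0), locSt_splice E r m r1 le_rfl]
      exact ⟨ha1, ha2, ha3⟩

theorem isRun_of_follows {E : Env S ACTe ACT1 O PP} {P : List O → Set ACT1} {r : ℕ → S}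
    (h0 : r 0 ∈ E.initSt) (h : E.Follows P [E.obs (r 0)] r) : E.IsRun P r := by
  refine ⟨h0, fun m => ?_⟩
  obtain ⟨a, h1, h2, h3⟩ := h m
  exact ⟨a, h1, by rwa [vtx_obs] at h2, h3⟩

theorem exists_follows (E : Env S ACTe ACT1 O PP) (P : List O → Set ACT1)
    (hne : ∀ v, (P v).Nonempty) (v : List O) (s : S) :
    ∃ r, r 0 = s ∧ E.Follows P v r := by
  choose p hp using hne
  choose q hq using E.Pe_ne
  let step : S × List O → S × List O := fun x =>
    let t := E.tr (q x.1, p x.2) x.1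
    (t, x.2 ++ [E.obs t])
  let f : ℕ → S × List O := fun n => step^[n] (s, v)
  have hf : ∀ n, f (n + 1) = step (f n) := fun n => Function.iterate_succ_apply' _ _ _
  have hv : ∀ n, E.vtx v (fun n => (f n).1) n = (f n).2 := by
    intro n
    induction n with
    | zero => rfl
    | succ n ih => rw [vtx, ih, hf]
  refine ⟨fun n => (f n).1, rfl, fun m => ⟨(q (f m).1, p (f m).2), hq _, ?_, ?_⟩⟩
  · rw [hv]; exact hp _
  · change (f (m + 1)).1 = _
    rw [hf]

/-- Prepend a state. -/
def consSeq (s : S) (r : ℕ → S) : ℕ → S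
  | 0 => s
  | n + 1 => r n

theorem vtx_cons (E : Env S ACTe ACT1 O PP) (s : S) (r : ℕ → S) (v : List O) (j : ℕ) :
    E.vtx v (consSeq s r) (j + 1) = E.vtx (v ++ [E.obs (r 0)]) r j := by
  induction j with
  | zero => rfl
  | succ j ih => rw [vtx, ih]; rfl

theorem exists_follows_step (E : Env S ACTe ACT1 O PP) (P : List O → Set ACT1)
    (hne : ∀ v, (P v).Nonempty) (v : List O) (s : S) (a : ACTe × ACT1)
    (h1 : a.1 ∈ E.Pe s) (h2 : a.2 ∈ P v) :
    ∃ r, r 0 = s ∧ r 1 = E.tr a s ∧ E.Follows P v r := by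
  obtain ⟨r, hr0, hr⟩ := E.exists_follows P hne (v ++ [E.obs (E.tr a s)]) (E.tr a s)
  refine ⟨consSeq s r, rfl, hr0, fun m => ?_⟩
  rcases m with _ | m
  · exact ⟨a, h1, h2, hr0⟩
  · obtain ⟨b, hb⟩ := hr m
    refine ⟨b, ?_⟩
    rw [vtx_cons, hr0]
    exact hb

theorem sat_congr (E : Env S ACTe ACT1 O PP) (P : List O → Set ACT1) (φ : Fml PP) :
    ∀ (r r' : ℕ → S) (m : ℕ), E.IsRun P r → E.IsRun P r' → E.locSt r m = E.locSt r' m →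
      (∀ j, r (m + j) = r' (m + j)) → (E.sat P r m φ ↔ E.sat P r' m φ) := by
  have key : ∀ (r r' : ℕ → S) (m k : ℕ), E.locSt r m = E.locSt r' m →
      (∀ j, r (m + j) = r' (m + j)) → m ≤ k →
      E.locSt r k = E.locSt r' k ∧ ∀ j, r (k + j) = r' (k + j) := by
    intro r r' m k hl he hk
    obtain ⟨i, rfl⟩ := Nat.exists_eq_add_of_le hk
    refine ⟨?_, fun j => ?_⟩
    · rw [← vtx_locSt E r _ m (fun _ => rfl), hl, ← vtx_locSt E r' _ m (fun _ => rfl)]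
      congr 1
      exact funext he
    · rw [Nat.add_assoc]; exact he _
  induction φ with
  | tru => intros; simp [sat]
  | atom p =>
    intro r r' m _ _ _ he
    have := he 0
    simp only [Nat.add_zero] at this
    simp [sat, this]
  | neg φ ih =>
    intro r r' m h h' hl he
    simp only [sat]; rw [ih r r' m h h' hl he]
  | conj φ χ ih1 ih2 =>
    intro r r' m h h' hl he
    simp only [sat]; rw [ih1 r r' m h h' hl he, ih2 r r' m h h' hl he]
  | next φ ih =>
    intro r r' m h h' hl he
    simp only [sat]
    obtain ⟨a, b⟩ := key r r' m (m + 1) hl he (by omega)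
    exact ih r r' (m + 1) h h' a b
  | untl φ χ ih1 ih2 =>
    intro r r' m h h' hl he
    simp only [sat]
    refine exists_congr fun k => and_congr_right fun hk => and_congr ?_ ?_
    · obtain ⟨a, b⟩ := key r r' m k hl he hk
      exact ih2 r r' k h h' a b
    · refine forall_congr' fun l => imp_congr_right fun hl' => imp_congr_right fun _ => ?_
      obtain ⟨a, b⟩ := key r r' m l hl he hl'
      exact ih1 r r' l h h' a b
  | exis φ ih =>
    have one : ∀ (r r' : ℕ → S) (m : ℕ), E.IsRun P r' →
      E.locSt r m = E.locSt r' m → r m = r' m → E.sat P r m (.exis φ) →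
      E.sat P r' m (.exis φ) := by
      intro r r' m h' hl he hs
      simp only [sat] at hs ⊢
      obtain ⟨r1, hr1, hp, hs⟩ := hs
      have hl1 : E.locSt r1 m = E.locSt r' m := by rw [E.locSt_congr hp, hl]
      have h0 : (fun j => r1 (m + j)) 0 = r' m := by
        change r1 m = _
        rw [hp m le_rfl, he]
      have hrun := h'.splice m h0 (by rw [← hl1]; exact hr1.follows m)
      refine ⟨_, hrun, fun k hk => splice_le _ _ _ hk, ?_⟩
      refine (ih r1 _ m hr1 hrun ?_ ?_).1 hs
      · rw [locSt_splice E _ _ _ le_rfl, hl1]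
      · intro j; rw [splice_add _ _ _ h0]
    intro r r' m h h' hl he
    exact ⟨one r r' m h' hl (he 0), one r' r m h hl.symm (he 0).symm⟩
  | know φ ih =>
    intro r r' m h h' hl he
    simp only [sat, hl]

open Classical in
/-- The canonical tree of a protocol. -/
noncomputable def canT (E : Env S ACTe ACT1 O PP) (P : List O → Set ACT1) : LTree S ACT1 O PP :=
  fun v => ({x | ∃ r m, E.IsRun P r ∧ E.locSt r m = v ∧ x.2 = r m ∧
    ∀ φ, x.1 φ = true ↔ E.sat P r m φ}, P v)

theorem mem_canT (E : Env S ACTe ACT1 O PP) (P : List O → Set ACT1) (v : List O)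
    (X : Fml PP → Bool) (s : S) : (X, s) ∈ (E.canT P v).1 ↔
    ∃ r m, E.IsRun P r ∧ E.locSt r m = v ∧ s = r m ∧ ∀ φ, X φ = true ↔ E.sat P r m φ :=
  Iff.rfl

open Classical in
theorem canT_of_run (E : Env S ACTe ACT1 O PP) (P : List O → Set ACT1) {r : ℕ → S}
    (hr : E.IsRun P r) (m : ℕ) :
    ∃ X : Fml PP → Bool, (X, r m) ∈ (E.canT P (E.locSt r m)).1 ∧
      ∀ φ, X φ = true ↔ E.sat P r m φ :=
  ⟨fun φ => decide (E.sat P r m φ), ⟨r, m, hr, rfl, rfl, by simp⟩, by simp⟩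

/-- splice of two runs meeting at the same local state and state -/
theorem splice_runs (E : Env S ACTe ACT1 O PP) (P : List O → Set ACT1) {r r1 : ℕ → S}
    {m m1 : ℕ} (hr : E.IsRun P r) (hr1 : E.IsRun P r1) (hl : E.locSt r1 m1 = E.locSt r m)
    (h : r1 m1 = r m) {φ : Fml PP} (hs : E.sat P r1 m1 φ) :
    E.sat P r m (.exis φ) := by
  obtain rfl := E.locSt_inj hl
  have h0 : (fun j => r1 (m1 + j)) 0 = r m1 := h
  have hrun := hr.splice m1 h0 (by rw [← hl]; exact hr1.follows m1)
  simp only [sat]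
  refine ⟨_, hrun, fun k hk => splice_le _ _ _ hk, ?_⟩
  refine (sat_congr E P φ r1 _ m1 hr1 hrun ?_ ?_).1 hs
  · rw [locSt_splice E _ _ _ le_rfl, hl]
  · intro j; rw [splice_add _ _ _ h0]

theorem tsat_canT (E : Env S ACTe ACT1 O PP) (P : List O → Set ACT1) {r r1 : ℕ → S}
    (hr : E.IsRun P r) (m : ℕ) (h : ∀ j, r (m + j) = r1 j) (φ : Fml PP) :
    ∀ j, E.tsat (E.canT P) (E.locSt r m) r1 j φ ↔ E.sat P r (m + j) φ := by
  induction φ with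
  | tru => simp [sat, tsat]
  | atom p => simp [sat, tsat, h]
  | neg φ ih => simp [sat, tsat, ih]
  | conj φ χ ih1 ih2 => simp [sat, tsat, ih1, ih2]
  | next φ ih => intro j; simp only [sat, tsat, ih]; rfl
  | untl φ χ ih1 ih2 =>
    intro j
    simp only [sat, tsat, ih1, ih2]
    constructor
    · rintro ⟨k, hk, h2, h1⟩
      refine ⟨m + k, by omega, h2, fun l hl hl' => ?_⟩
      obtain ⟨i, rfl⟩ := Nat.exists_eq_add_of_le (show m ≤ l by omega)
      exact h1 i (by omega) (by omega)
    · rintro ⟨k, hk, h2, h1⟩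
      obtain ⟨i, rfl⟩ := Nat.exists_eq_add_of_le (show m ≤ k by omega)
      exact ⟨i, by omega, h2, fun l hl hl' => h1 _ (by omega) (by omega)⟩
  | exis φ ih =>
    intro j
    rw [tsat, vtx_locSt E r r1 m h, ← h]
    constructor
    · rintro ⟨X, ⟨r2, m2, hr2, hl, hs, hX⟩, hXφ⟩
      exact splice_runs E P hr hr2 hl hs.symm ((hX φ).1 hXφ)
    · rw [sat]
      rintro ⟨r2, hr2, hp, hs⟩
      obtain ⟨X, hX, hX'⟩ := canT_of_run E P hr2 (m + j)
      rw [hp _ le_rfl, E.locSt_congr hp] at hX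
      exact ⟨X, hX, (hX' φ).2 hs⟩
  | know φ ih =>
    intro j
    rw [tsat, vtx_locSt E r r1 m h, sat]
    constructor
    · intro hk r2 m2 hr2 hl
      obtain ⟨X, hX, hX'⟩ := canT_of_run E P hr2 m2
      rw [hl] at hX
      exact (hX' φ).1 (hk X _ hX)
    · rintro hk X s ⟨r2, m2, hr2, hl, hs, hX⟩
      exact (hX φ).2 (hk r2 m2 hr2 hl)

theorem acceptable_canT (E : Env S ACTe ACT1 O PP) (P : List O → Set ACT1)
    (hne : ∀ v, (P v).Nonempty) (ψ : Fml PP) (hP : E.Realizes P ψ) :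
    E.Acceptable ψ (E.canT P) where
  actNe := hne
  real := by
    rintro o X s ⟨r, m, hr, hl, hs, hX⟩
    have : m = 0 := by
      have := E.locSt_length r m
      rw [hl] at this
      simpa using this.symm
    subst this
    simp only at hs
    subst hs
    exact ⟨(hX ψ).2 (hP r hr), hr.1⟩
  initC := by
    intro s hs
    obtain ⟨r, rfl, hr⟩ := E.exists_follows P hne [E.obs s] s
    have hrun := isRun_of_follows hs hr
    obtain ⟨X, hX, _⟩ := canT_of_run E P hrun 0
    rw [locSt_zero] at hX
    exact ⟨X, hX⟩
  obsC := by
    rintro v o X s ⟨r, m, hr, hl, hs, hX⟩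
    simp only at hs
    subst hs
    rcases m with _ | m
    · rw [locSt_zero] at hl
      exact (List.append_inj' (s₁ := []) hl rfl).2 |> List.singleton_inj.1
    · rw [locSt_succ] at hl
      exact (List.append_inj' hl rfl).2 |> List.singleton_inj.1
  pred := by
    rintro v o X s hv ⟨r, m, hr, hl, hs, hX⟩
    simp only at hs
    subst hs
    rcases m with _ | m
    · rw [locSt_zero] at hl
      exact absurd (List.append_inj' (s₁ := []) hl rfl).1.symm hv
    · rw [locSt_succ] at hl
      obtain rfl := (List.append_inj' hl rfl).1
      obtain ⟨Y, hY, _⟩ := canT_of_run E P hr m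
      obtain ⟨a, h1, h2, h3⟩ := hr.2 m
      exact ⟨Y, _, a, hY, h1, h2, h3⟩
  succ := by
    rintro v X s a hv ⟨r, m, hr, rfl, hs, hX⟩ h1 h2
    obtain ⟨r1, h10, h11, hf⟩ := E.exists_follows_step P hne _ s a h1 h2
    have h0 : r1 0 = r m := by rw [h10]; exact hs
    have hrun := hr.splice m h0 hf
    obtain ⟨Y, hY, _⟩ := canT_of_run E P hrun (m + 1)
    rw [locSt_succ, locSt_splice E _ _ _ le_rfl, splice_add _ _ _ h0, h11] at hY
    exact ⟨Y, hY⟩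
  exSound := by
    rintro v X s φ _ ⟨r, m, hr, rfl, hs, hX⟩ h
    have := (hX _).1 h
    rw [sat] at this
    obtain ⟨r2, hr2, hp, hsat⟩ := this
    obtain ⟨Y, hY, hY'⟩ := canT_of_run E P hr2 m
    rw [hp _ le_rfl, E.locSt_congr hp, ← hs] at hY
    exact ⟨Y, hY, (hY' φ).2 hsat⟩
  exComp := by
    rintro v X Y s φ _ ⟨r, m, hr, hl, hs, hX⟩ ⟨r', m', hr', hl', hs', hY⟩ h
    exact (hY _).2 (splice_runs E P hr' hr (hl.trans hl'.symm) (hs.symm.trans hs') ((hX φ).1 h))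
  ksound := by
    rintro v X s _ ⟨r, m, hr, rfl, hs, hX⟩
    obtain ⟨Y, hY, _⟩ := canT_of_run E P hr m
    refine ⟨fun j => r (m + j), ⟨⟨Y, hY⟩, hr.follows m⟩, hs.symm, fun φ _ => ?_⟩
    rw [tsat_canT E P hr m (fun _ => rfl)]
    exact (hX φ).symm
  kcomp := by
    rintro v r1 ⟨⟨X, r, m, hr, rfl, hs, hX⟩, hf⟩
    have h0 : r1 0 = r m := hs
    have hrun := hr.splice m h0 hf
    obtain ⟨Y, hY, hY'⟩ := canT_of_run E P hrun m
    have he := splice_add r m r1 h0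
    have h00 := he 0
    rw [Nat.add_zero] at h00
    have := fun φ => tsat_canT E P hrun m he φ 0
    rw [locSt_splice E _ _ _ le_rfl] at hY this
    rw [h00] at hY
    exact ⟨Y, hY, fun φ _ => (this φ).trans (hY' φ).symm⟩

theorem tsat_congr (E : Env S ACTe ACT1 O PP) (T : LTree S ACT1 O PP) (v v' : List O)
    (r r' : ℕ → S) (m : ℕ) (h : ∀ j, r (m + j) = r' j)
    (hv : ∀ j, E.vtx v r (m + j) = E.vtx v' r' j) (φ : Fml PP) :
    ∀ j, E.tsat T v r (m + j) φ ↔ E.tsat T v' r' j φ := by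
  induction φ with
  | tru => simp [tsat]
  | atom p => simp [tsat, h]
  | neg φ ih => simp [tsat, ih]
  | conj φ χ ih1 ih2 => simp [tsat, ih1, ih2]
  | next φ ih => intro j; simp only [tsat, Nat.add_assoc, ih]
  | untl φ χ ih1 ih2 =>
    intro j
    simp only [tsat, ← ih1, ← ih2]
    constructor
    · rintro ⟨k, hk, h2, h1⟩
      obtain ⟨i, rfl⟩ := Nat.exists_eq_add_of_le (show m ≤ k by omega)
      exact ⟨i, by omega, h2, fun l hl hl' => h1 _ (by omega) (by omega)⟩
    · rintro ⟨k, hk, h2, h1⟩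
      refine ⟨m + k, by omega, h2, fun l hl hl' => ?_⟩
      obtain ⟨i, rfl⟩ := Nat.exists_eq_add_of_le (show m ≤ l by omega)
      exact h1 i (by omega) (by omega)
  | exis φ ih => intro j; simp only [tsat, h, hv]
  | know φ ih => intro j; simp only [tsat, hv]

theorem tsat_shift (E : Env S ACTe ACT1 O PP) (T : LTree S ACT1 O PP)
    (r r' : ℕ → S) (m : ℕ) (h : ∀ j, r (m + j) = r' j) (φ : Fml PP) :
    E.tsat T [E.obs (r 0)] r m φ ↔ E.tsat T (E.locSt r m) r' 0 φ :=
  tsat_congr E T [E.obs (r 0)] (E.locSt r m) r r' m h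
    (fun j => by rw [vtx_obs, vtx_locSt E r r' m h]) φ 0

theorem mem_of_run (E : Env S ACTe ACT1 O PP) (ψ : Fml PP) (T : LTree S ACT1 O PP)
    (hT : E.Acceptable ψ T) {r : ℕ → S} (hr : E.IsRun (fun v => (T v).2) r) (m : ℕ) :
    ∃ X, (X, r m) ∈ (T (E.locSt r m)).1 := by
  induction m with
  | zero => rw [locSt_zero]; exact hT.initC _ hr.1
  | succ m ih =>
    obtain ⟨X, hX⟩ := ih
    obtain ⟨a, h1, h2, h3⟩ := hr.2 m
    rw [locSt_succ, h3]
    exact hT.succ _ X _ a (E.locSt_ne r m) hX h1 h2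

theorem run_of_mem (E : Env S ACTe ACT1 O PP) (ψ : Fml PP) (T : LTree S ACT1 O PP)
    (hT : E.Acceptable ψ T) (v : List O) : v ≠ [] → ∀ X s, (X, s) ∈ (T v).1 →
    ∃ r m, E.IsRun (fun v => (T v).2) r ∧ E.locSt r m = v ∧ r m = s := by
  induction v using List.reverseRecOn with
  | nil => intro h; exact absurd rfl h
  | append_singleton v o ih =>
    intro _ X s hX
    have ho := hT.obsC v o X s hX
    by_cases hv : v = []
    · subst hv
      obtain ⟨r, rfl, hr⟩ := E.exists_follows (fun v => (T v).2) hT.actNe [E.obs s] s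
      refine ⟨r, 0, isRun_of_follows (hT.real o X _ hX).2 hr, ?_, rfl⟩
      rw [locSt_zero, ho]; rfl
    · obtain ⟨Y, t, a, hY, h1, h2, h3⟩ := hT.pred v o X s hv hX
      obtain ⟨r, m, hr, rfl, rfl⟩ := ih hv Y t hY
      obtain ⟨r1, h10, h11, hf⟩ :=
        E.exists_follows_step (fun v => (T v).2) hT.actNe _ (r m) a h1 h2
      have hrun := hr.splice m h10 hf
      refine ⟨_, m + 1, hrun, ?_, ?_⟩
      · rw [locSt_succ, locSt_splice E _ _ _ le_rfl, splice_add _ _ _ h10, h11, ← h3, ho]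
      · rw [splice_add _ _ _ h10, h11, h3]

theorem subf_self (φ : Fml PP) : φ ∈ φ.subf := by
  cases φ <;> simp [Fml.subf]

theorem exists_atom (E : Env S ACTe ACT1 O PP) (ψ : Fml PP) (T : LTree S ACT1 O PP)
    (hT : E.Acceptable ψ T) {r : ℕ → S} (hr : E.IsRun (fun v => (T v).2) r) (m : ℕ) :
    ∃ X, (X, r m) ∈ (T (E.locSt r m)).1 ∧
      ∀ φ ∈ ψ.subf, (E.tsat T [E.obs (r 0)] r m φ ↔ X φ = true) := by
  obtain ⟨X, hX, h⟩ := hT.kcomp (E.locSt r m) (fun j => r (m + j))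
    ⟨E.mem_of_run ψ T hT hr m, hr.follows m⟩
  refine ⟨X, hX, fun φ hφ => ?_⟩
  rw [← h φ hφ]
  exact tsat_shift E T r _ m (fun _ => rfl) φ

theorem exists_run (E : Env S ACTe ACT1 O PP) (ψ : Fml PP) (T : LTree S ACT1 O PP)
    (hT : E.Acceptable ψ T) {r : ℕ → S} (hr : E.IsRun (fun v => (T v).2) r) (m : ℕ)
    (X : Fml PP → Bool) (hX : (X, r m) ∈ (T (E.locSt r m)).1) :
    ∃ r', E.IsRun (fun v => (T v).2) r' ∧ (∀ k, k ≤ m → r' k = r k) ∧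
      ∀ φ ∈ ψ.subf, (E.tsat T [E.obs (r' 0)] r' m φ ↔ X φ = true) := by
  obtain ⟨r1, hr1, h0, h⟩ := hT.ksound _ X _ (E.locSt_ne r m) hX
  refine ⟨_, hr.splice m h0 hr1.2, fun k hk => splice_le _ _ _ hk, fun φ hφ => ?_⟩
  rw [← h φ hφ, tsat_shift E T _ r1 m (splice_add _ _ _ h0), locSt_splice E _ _ _ le_rfl]

theorem tsat_iff_sat (E : Env S ACTe ACT1 O PP) (ψ : Fml PP) (T : LTree S ACT1 O PP)
    (hT : E.Acceptable ψ T) (φ : Fml PP) : (∀ χ ∈ φ.subf, χ ∈ ψ.subf) →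
    ∀ r m, E.IsRun (fun v => (T v).2) r →
      (E.tsat T [E.obs (r 0)] r m φ ↔ E.sat (fun v => (T v).2) r m φ) := by
  induction φ with
  | tru => intros; simp [tsat, sat]
  | atom p => intros; simp [tsat, sat]
  | neg φ ih =>
    intro hs r m hr
    simp only [tsat, sat, ih (fun χ h => hs χ (by simp [Fml.subf, h])) r m hr]
  | conj φ χ ih1 ih2 =>
    intro hs r m hr
    simp only [tsat, sat, ih1 (fun χ h => hs χ (by simp [Fml.subf, h])) r m hr,
      ih2 (fun χ h => hs χ (by simp [Fml.subf, h])) r m hr]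
  | next φ ih =>
    intro hs r m hr
    simp only [tsat, sat, ih (fun χ h => hs χ (by simp [Fml.subf, h])) r _ hr]
  | untl φ χ ih1 ih2 =>
    intro hs r m hr
    have e1 := fun m => ih1 (fun χ h => hs χ (by simp [Fml.subf, h])) r m hr
    have e2 := fun m => ih2 (fun χ h => hs χ (by simp [Fml.subf, h])) r m hr
    simp only [tsat, sat, e1, e2]
  | exis φ ih =>
    intro hs r m hr
    have hs' : ∀ χ ∈ φ.subf, χ ∈ ψ.subf := fun χ h => hs χ (by simp [Fml.subf, h])
    have hφ := hs' φ (subf_self φ)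
    rw [tsat, vtx_obs, sat]
    constructor
    · rintro ⟨X, hX, hXφ⟩
      obtain ⟨r', hr', hp, h⟩ := E.exists_run ψ T hT hr m X hX
      exact ⟨r', hr', hp, (ih hs' r' m hr').1 ((h φ hφ).2 hXφ)⟩
    · rintro ⟨r', hr', hp, h⟩
      obtain ⟨X, hX, hX'⟩ := E.exists_atom ψ T hT hr' m
      rw [hp m le_rfl, E.locSt_congr hp] at hX
      exact ⟨X, hX, (hX' φ hφ).1 ((ih hs' r' m hr').2 h)⟩
  | know φ ih =>
    intro hs r m hr
    have hs' : ∀ χ ∈ φ.subf, χ ∈ ψ.subf := fun χ h => hs χ (by simp [Fml.subf, h])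
    have hφ := hs' φ (subf_self φ)
    rw [tsat, vtx_obs, sat]
    constructor
    · intro hk r' m' hr' hl
      obtain ⟨X, hX, hX'⟩ := E.exists_atom ψ T hT hr' m'
      rw [hl] at hX
      exact (ih hs' r' m' hr').1 ((hX' φ hφ).2 (hk X _ hX))
    · intro hk X s hX
      obtain ⟨r1, m1, hr1, hl, rfl⟩ := E.run_of_mem ψ T hT _ (E.locSt_ne r m) X s hX
      rw [← hl] at hX
      obtain ⟨r', hr', hp, h⟩ := E.exists_run ψ T hT hr1 m1 X hX
      refine (h φ hφ).1 ((ih hs' r' m1 hr').2 (hk r' m1 hr' ?_))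
      rw [E.locSt_congr hp, hl]

theorem realizes_of_acceptable (E : Env S ACTe ACT1 O PP) (ψ : Fml PP) (T : LTree S ACT1 O PP)
    (hT : E.Acceptable ψ T) : E.Realizes (fun v => (T v).2) ψ := by
  intro r hr
  obtain ⟨X, hX, h⟩ := E.exists_atom ψ T hT hr 0
  rw [locSt_zero] at hX
  exact (E.tsat_iff_sat ψ T hT ψ (fun _ h => h) r 0 hr).1
    ((h ψ (subf_self ψ)).2 (hT.real _ X _ hX).1)

end Env

/-- **Theorem (characterization of realizability).** A specification ψ for a single agent
is realizable in the finite interpreted environment E iff there exists an acceptable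
labelled tree for ψ and E. -/
theorem stmt0 {S ACTe ACT1 O PP : Type} [Fintype S] [Fintype ACTe] [Fintype ACT1]
    [Fintype O] (E : Env S ACTe ACT1 O PP) (ψ : Fml PP) :
    E.Realizable ψ ↔ ∃ T : LTree S ACT1 O PP, E.Acceptable ψ T := by
  constructor
  · rintro ⟨P, hne, hP⟩
    exact ⟨_, Env.acceptable_canT E P hne ψ hP⟩
  · rintro ⟨T, hT⟩
    exact ⟨fun v => (T v).2, hT.actNe, Env.realizes_of_acceptable E ψ T hT⟩
end

section
/- Let P realize ψ in E, let ℐ = ℐ(P,E), and let 𝒯 be the canonical labelled tree with K(v) = { (X(r,m), r(m)) : r_1(m) = v } where X(r,m)(φ)=1 iff ℐ,(r,m) ⊨ φ, and 𝒯(v) = (K(v),P(v)). Then for every point (r,m) of ℐ and every subformula φ of ψ: ℐ,(r,m) ⊨ φ if and only if 𝒯,(r,m) ⊨* φ. -/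
section Helpers
variable {S ACTe ACT1 O PP : Type}

theorem subf_trans {φ ψ : Fml PP} (h : φ ∈ ψ.subf) : ∀ χ ∈ φ.subf, χ ∈ ψ.subf := by
  induction ψ with
  | tru => simp only [Fml.subf, List.mem_singleton] at h; subst h; exact fun _ h => h
  | atom p => simp only [Fml.subf, List.mem_singleton] at h; subst h; exact fun _ h => h
  | neg a iha | next a iha | exis a iha | know a iha =>
    intro χ hχ
    rcases List.mem_cons.1 h with h | h
    · subst h; exact hχ
    · exact List.mem_cons_of_mem _ (iha h χ hχ)
  | conj a b iha ihb | untl a b iha ihb =>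
    intro χ hχ
    rcases List.mem_cons.1 h with h | h
    · subst h; exact hχ
    · rcases List.mem_append.1 h with h | h
      · exact List.mem_cons_of_mem _ (List.mem_append_left _ (iha h χ hχ))
      · exact List.mem_cons_of_mem _ (List.mem_append_right _ (ihb h χ hχ))

theorem self_mem_subf (φ : Fml PP) : φ ∈ φ.subf := by
  cases φ <;> simp [Fml.subf]

theorem locSt_length (E : Env S ACTe ACT1 O PP) (r : ℕ → S) (m : ℕ) :
    (E.locSt r m).length = m + 1 := by simp [Env.locSt]

theorem locSt_ne (E : Env S ACTe ACT1 O PP) (r : ℕ → S) (m : ℕ) : E.locSt r m ≠ [] := by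
  intro h
  have := locSt_length E r m
  simp [h] at this

theorem locSt_time (E : Env S ACTe ACT1 O PP) {r r' : ℕ → S} {m m' : ℕ}
    (h : E.locSt r m = E.locSt r' m') : m = m' := by
  have h1 := congrArg List.length h
  rw [locSt_length, locSt_length] at h1
  omega

theorem locSt_succ (E : Env S ACTe ACT1 O PP) (r : ℕ → S) (m : ℕ) :
    E.locSt r (m + 1) = E.locSt r m ++ [E.obs (r (m + 1))] := by
  simp [Env.locSt, List.range_succ]

theorem vtx_eq (E : Env S ACTe ACT1 O PP) (r : ℕ → S) (m : ℕ) :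
    E.vtx (E.locSt r 0) r m = E.locSt r m := by
  induction m with
  | zero => rfl
  | succ m ih => rw [Env.vtx, ih, locSt_succ]

theorem locSt_congr (E : Env S ACTe ACT1 O PP) {r r' : ℕ → S} {m : ℕ}
    (h : ∀ k, k ≤ m → r k = r' k) : E.locSt r m = E.locSt r' m := by
  apply List.map_congr_left
  intro k hk
  rw [h k (by have := List.mem_range.1 hk; omega)]

theorem locSt_ge (E : Env S ACTe ACT1 O PP) {r r' : ℕ → S} {m : ℕ}
    (h : E.locSt r m = E.locSt r' m) (h' : ∀ k, m ≤ k → r k = r' k) (k : ℕ) (hk : m ≤ k) :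
    E.locSt r k = E.locSt r' k := by
  induction k, hk using Nat.le_induction with
  | base => exact h
  | succ k hk ih => rw [locSt_succ, locSt_succ, ih, h' (k + 1) (by omega)]

/-- The run following `r` up to time `m` and `r'` afterwards. -/
def fuse (r r' : ℕ → S) (m : ℕ) : ℕ → S := fun k => if k ≤ m then r k else r' k

theorem fuse_le (r r' : ℕ → S) {m k : ℕ} (h : k ≤ m) : fuse r r' m k = r k := if_pos h

theorem fuse_ge {r r' : ℕ → S} {m : ℕ} (e : r m = r' m) (k : ℕ) (h : m ≤ k) :
    fuse r r' m k = r' k := by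
  rcases h.eq_or_lt with rfl | h
  · rw [fuse_le _ _ le_rfl, e]
  · exact if_neg (by omega)

theorem fuse_locSt (E : Env S ACTe ACT1 O PP) (r r' : ℕ → S) (m : ℕ) :
    E.locSt (fuse r r' m) m = E.locSt r m :=
  locSt_congr E fun _ hk => fuse_le _ _ hk

theorem fuse_run (E : Env S ACTe ACT1 O PP) {P : List O → Set ACT1} {r r' : ℕ → S} {m : ℕ}
    (hr : E.IsRun P r) (hr' : E.IsRun P r') (e : r m = r' m)
    (h : E.locSt r m = E.locSt r' m) : E.IsRun P (fuse r r' m) := by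
  refine ⟨by rw [fuse_le _ _ (Nat.zero_le m)]; exact hr.1, fun k => ?_⟩
  by_cases hk : k < m
  · rw [fuse_le _ _ hk.le, fuse_le _ _ (show k + 1 ≤ m from hk),
      locSt_congr E (r := fuse r r' m) (r' := r) (m := k)
        (fun j hj => fuse_le _ _ (by omega))]
    exact hr.2 k
  · rw [fuse_ge e k (by omega), fuse_ge e (k + 1) (by omega),
      locSt_ge E ((fuse_locSt E r r' m).trans h) (fuse_ge e) k (by omega)]
    exact hr'.2 k

theorem sat_congr (E : Env S ACTe ACT1 O PP) (P : List O → Set ACT1) (φ : Fml PP) :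
    ∀ (r r' : ℕ → S) (m : ℕ), E.IsRun P r → E.IsRun P r' → E.locSt r m = E.locSt r' m →
      (∀ k, m ≤ k → r k = r' k) → (E.sat P r m φ → E.sat P r' m φ) := by
  suffices H : ∀ (r r' : ℕ → S) (m : ℕ), E.IsRun P r → E.IsRun P r' →
      E.locSt r m = E.locSt r' m →
      (∀ k, m ≤ k → r k = r' k) → (E.sat P r m φ ↔ E.sat P r' m φ) from
    fun r r' m a b c d => (H r r' m a b c d).1
  induction φ with
  | tru => intros; simp [Env.sat]
  | atom p => intro r r' m _ _ _ h; simp [Env.sat, h m le_rfl]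
  | neg a iha => intro r r' m h1 h2 h3 h4; simp only [Env.sat, iha r r' m h1 h2 h3 h4]
  | conj a b iha ihb =>
    intro r r' m h1 h2 h3 h4
    simp only [Env.sat, iha r r' m h1 h2 h3 h4, ihb r r' m h1 h2 h3 h4]
  | next a iha =>
    intro r r' m h1 h2 h3 h4
    exact iha r r' (m + 1) h1 h2 (locSt_ge E h3 h4 _ (by omega)) fun k hk => h4 k (by omega)
  | untl a b iha ihb =>
    intro r r' m h1 h2 h3 h4
    have ha : ∀ k, m ≤ k → (E.sat P r k a ↔ E.sat P r' k a) := fun k hk =>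
      iha r r' k h1 h2 (locSt_ge E h3 h4 k hk) fun j hj => h4 j (by omega)
    have hb : ∀ k, m ≤ k → (E.sat P r k b ↔ E.sat P r' k b) := fun k hk =>
      ihb r r' k h1 h2 (locSt_ge E h3 h4 k hk) fun j hj => h4 j (by omega)
    simp only [Env.sat]
    constructor
    · rintro ⟨k, hk, h, h'⟩
      exact ⟨k, hk, (hb k hk).1 h, fun l hl hl' => (ha l hl).1 (h' l hl hl')⟩
    · rintro ⟨k, hk, h, h'⟩
      exact ⟨k, hk, (hb k hk).2 h, fun l hl hl' => (ha l hl).2 (h' l hl hl')⟩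
  | know a iha =>
    intro r r' m h1 h2 h3 h4
    simp only [Env.sat, h3]
  | exis a iha =>
    have key : ∀ (r r' : ℕ → S) (m : ℕ), E.IsRun P r → E.IsRun P r' →
        E.locSt r m = E.locSt r' m → (∀ k, m ≤ k → r k = r' k) →
        E.sat P r m (.exis a) → E.sat P r' m (.exis a) := by
      intro r r' m h1 h2 h3 h4 h
      simp only [Env.sat] at h ⊢
      obtain ⟨q, hq, hqr, hs⟩ := h
      have e : r' m = q m := by rw [hqr m le_rfl, h4 m le_rfl]
      have hl : E.locSt r' m = E.locSt q m := by rw [← h3]; exact (locSt_congr E hqr).symm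
      have hf := fuse_run E h2 hq e hl
      exact ⟨fuse r' q m, hf, fun k hk => fuse_le _ _ hk,
        (iha _ _ m hf hq ((fuse_locSt E r' q m).trans hl) (fuse_ge e)).2 hs⟩
    intro r r' m h1 h2 h3 h4
    exact ⟨key r r' m h1 h2 h3 h4, key r' r m h2 h1 h3.symm fun k hk => (h4 k hk).symm⟩

end Helpers

/-- **Theorem.** Let P realize ψ in E, ℐ = ℐ(P,E), and let 𝒯 be the canonical labelled
tree with K(v) = { (X(r,m), r(m)) : r₁(m) = v } where X(r,m)(φ)=1 iff ℐ,(r,m) ⊨ φ (on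
subformulae of ψ), and action labels P(v).  Then for every point (r,m) of ℐ and every
subformula φ of ψ:  ℐ,(r,m) ⊨ φ  iff  𝒯,(r,m) ⊨* φ  (i.e. 𝒯, r₁(0), (r,m) ⊨* φ). -/
theorem stmt4 {S ACTe ACT1 O PP : Type} [Fintype S] [Fintype ACTe] [Fintype ACT1]
    [Fintype O] (E : Env S ACTe ACT1 O PP) (ψ : Fml PP) (P : List O → Set ACT1)
    (hPne : ∀ v, (P v).Nonempty) (hreal : E.Realizes P ψ)
    (T : LTree S ACT1 O PP)
    (hK : ∀ v : List O, v ≠ [] → ∀ (X : Fml PP → Bool) (s : S),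
      ((X, s) ∈ (T v).1 ↔ ∃ r m, E.IsRun P r ∧ E.locSt r m = v ∧ r m = s ∧
        ∀ φ ∈ ψ.subf, (X φ = true ↔ E.sat P r m φ)))
    (hP : ∀ v : List O, v ≠ [] → (T v).2 = P v)
    (r : ℕ → S) (m : ℕ) (hr : E.IsRun P r) (φ : Fml PP) (hφ : φ ∈ ψ.subf) :
    E.sat P r m φ ↔ E.tsat T (E.locSt r 0) r m φ := by
  classical
  have mem : ∀ (q : ℕ → S) (k : ℕ), E.IsRun P q →
      ((fun χ => decide (E.sat P q k χ)), q k) ∈ (T (E.locSt q k)).1 := fun q k hq =>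
    (hK _ (locSt_ne E q k) _ _).2 ⟨q, k, hq, rfl, rfl, fun χ _ => by simp⟩
  have hsub := subf_trans hφ
  clear hφ
  induction φ generalizing m with
  | tru => simp [Env.sat, Env.tsat]
  | atom p => simp [Env.sat, Env.tsat]
  | neg a iha =>
    have ha := iha (hsub := fun χ h => hsub χ (List.mem_cons_of_mem _ h))
    simp only [Env.sat, Env.tsat, ha]
  | conj a b iha ihb =>
    have ha := iha (hsub := fun χ h => hsub χ (List.mem_cons_of_mem _ (List.mem_append_left _ h)))
    have hb := ihb (hsub := fun χ h => hsub χ (List.mem_cons_of_mem _ (List.mem_append_right _ h)))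
    simp only [Env.sat, Env.tsat, ha, hb]
  | next a iha =>
    have ha := iha (hsub := fun χ h => hsub χ (List.mem_cons_of_mem _ h))
    simp only [Env.sat, Env.tsat, ha]
  | untl a b iha ihb =>
    have ha := iha (hsub := fun χ h => hsub χ (List.mem_cons_of_mem _ (List.mem_append_left _ h)))
    have hb := ihb (hsub := fun χ h => hsub χ (List.mem_cons_of_mem _ (List.mem_append_right _ h)))
    simp only [Env.sat, Env.tsat, ha, hb]
  | exis a iha =>
    have haψ : a ∈ ψ.subf := hsub a (List.mem_cons_of_mem _ (self_mem_subf a))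
    simp only [Env.sat, Env.tsat, vtx_eq]
    constructor
    · rintro ⟨q, hq, hqr, hs⟩
      refine ⟨fun χ => decide (E.sat P q m χ), ?_, by simpa using hs⟩
      have := mem q m hq
      rwa [locSt_congr E hqr, hqr m le_rfl] at this
    · rintro ⟨X, hX, hXa⟩
      obtain ⟨q, m', hq, hl, e, hs⟩ := (hK _ (locSt_ne E r m) _ _).1 hX
      obtain rfl := locSt_time E hl
      have hf := fuse_run E hr hq e.symm hl.symm
      exact ⟨fuse r q m', hf, fun k hk => fuse_le _ _ hk,
        sat_congr E P a _ _ _ hq hf (hl.trans (fuse_locSt E r q m').symm)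
          (fun k hk => (fuse_ge e.symm k hk).symm) ((hs a haψ).1 hXa)⟩
  | know a iha =>
    have haψ : a ∈ ψ.subf := hsub a (List.mem_cons_of_mem _ (self_mem_subf a))
    simp only [Env.sat, Env.tsat, vtx_eq]
    constructor
    · intro h X s hX
      obtain ⟨q, m', hq, hl, e, hs⟩ := (hK _ (locSt_ne E r m) _ _).1 hX
      exact (hs a haψ).2 (h q m' hq hl)
    · intro h q m' hq hl
      have := mem q m' hq
      rw [hl] at this
      simpa using h _ _ this
end

section
/- There is a constant c such that for every linear temporal logic formula φ over a finite set Prop of atomic propositions, there exists a nondeterministic Büchi word automaton A_φ over the alphabet 2^Prop with at most 2^{c·|φ|} states whose language is exactly the set of infinite words over 2^Prop (computations) that satisfy φ. -/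
/-! Linear temporal logic and nondeterministic Büchi automata on infinite words. -/

/-- Linear temporal logic formulae over atomic propositions `PP`: built with ¬, ∧,
○ (next) and U (until). -/
inductive LTLF (PP : Type) : Type
  | atom : PP → LTLF PP
  | neg : LTLF PP → LTLF PP
  | conj : LTLF PP → LTLF PP → LTLF PP
  | next : LTLF PP → LTLF PP
  | untl : LTLF PP → LTLF PP → LTLF PP

/-- The size |φ| of an LTL formula. -/
def LTLF.size {PP : Type} : LTLF PP → ℕ
  | atom _ => 1
  | neg φ => φ.size + 1
  | conj φ ψ => φ.size + ψ.size + 1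
  | next φ => φ.size + 1
  | untl φ ψ => φ.size + ψ.size + 1

/-- Satisfaction of an LTL formula at position `k` of an infinite word over 2^PP. -/
def LTLSat {PP : Type} (w : ℕ → Set PP) : ℕ → LTLF PP → Prop
  | k, .atom p => p ∈ w k
  | k, .neg φ => ¬ LTLSat w k φ
  | k, .conj φ ψ => LTLSat w k φ ∧ LTLSat w k ψ
  | k, .next φ => LTLSat w (k + 1) φ
  | k, .untl φ ψ => ∃ j, k ≤ j ∧ LTLSat w j ψ ∧ ∀ l, k ≤ l → l < j → LTLSat w l φ

/-- A nondeterministic Büchi automaton on infinite words. -/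
structure NBA (Sig : Type) : Type 1 where
  Q : Type
  [fin : Fintype Q]
  start : Set Q
  δ : Q → Sig → Set Q
  F : Set Q

instance {Sig : Type} (A : NBA Sig) : Fintype A.Q := A.fin

/-- `A` accepts `w` iff some run of `A` on `w` visits some accepting state infinitely
often. -/
def NBA.Accepts {Sig : Type} (A : NBA Sig) (w : ℕ → Sig) : Prop :=
  ∃ ρ : ℕ → A.Q, ρ 0 ∈ A.start ∧ (∀ i, ρ (i + 1) ∈ A.δ (ρ i) (w i)) ∧
    ∃ q ∈ A.F, ∀ n, ∃ m, n ≤ m ∧ ρ m = q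

namespace LTLAux
open Classical LTLF

noncomputable section

/-- The finite set of subformulae. -/
def sub {PP : Type} : LTLF PP → Finset (LTLF PP)
  | atom p => {atom p}
  | neg φ => insert (neg φ) (sub φ)
  | conj φ ψ => insert (conj φ ψ) (sub φ ∪ sub ψ)
  | next φ => insert (next φ) (sub φ)
  | untl φ ψ => insert (untl φ ψ) (sub φ ∪ sub ψ)

theorem sub_card {PP : Type} (φ : LTLF PP) : (sub φ).card ≤ φ.size := by
  induction φ with
  | atom p => simp [sub, LTLF.size]
  | neg φ ih => exact (Finset.card_insert_le _ _).trans (by simp only [LTLF.size]; omega)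
  | next φ ih => exact (Finset.card_insert_le _ _).trans (by simp only [LTLF.size]; omega)
  | conj φ ψ ih1 ih2 =>
    have := Finset.card_union_le (sub φ) (sub ψ)
    exact (Finset.card_insert_le _ _).trans (by simp only [LTLF.size]; omega)
  | untl φ ψ ih1 ih2 =>
    have := Finset.card_union_le (sub φ) (sub ψ)
    exact (Finset.card_insert_le _ _).trans (by simp only [LTLF.size]; omega)

theorem self_mem {PP : Type} (φ : LTLF PP) : φ ∈ sub φ := by
  cases φ <;> simp [sub]

theorem sub_trans {PP : Type} (φ : LTLF PP) : ∀ χ ∈ sub φ, sub χ ⊆ sub φ := by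
  induction φ with
  | atom p => intro χ h; simp only [sub, Finset.mem_singleton] at h; subst h; rfl
  | neg φ ih =>
    intro χ h
    simp only [sub, Finset.mem_insert] at h
    rcases h with rfl | h
    · rfl
    · exact (ih χ h).trans (Finset.subset_insert _ _)
  | next φ ih =>
    intro χ h
    simp only [sub, Finset.mem_insert] at h
    rcases h with rfl | h
    · rfl
    · exact (ih χ h).trans (Finset.subset_insert _ _)
  | conj φ ψ ih1 ih2 =>
    intro χ h
    simp only [sub, Finset.mem_insert, Finset.mem_union] at h
    rcases h with rfl | h | h
    · rfl
    · exact ((ih1 χ h).trans Finset.subset_union_left).trans (Finset.subset_insert _ _)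
    · exact ((ih2 χ h).trans Finset.subset_union_right).trans (Finset.subset_insert _ _)
  | untl φ ψ ih1 ih2 =>
    intro χ h
    simp only [sub, Finset.mem_insert, Finset.mem_union] at h
    rcases h with rfl | h | h
    · rfl
    · exact ((ih1 χ h).trans Finset.subset_union_left).trans (Finset.subset_insert _ _)
    · exact ((ih2 χ h).trans Finset.subset_union_right).trans (Finset.subset_insert _ _)

/-- Local consistency of two successive states with the letter read. -/
def Loc {PP : Type} (X : Finset (LTLF PP)) (a : Set PP) (Y : Finset (LTLF PP)) : LTLF PP → Prop
  | atom p => atom p ∈ X ↔ p ∈ a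
  | neg φ => neg φ ∈ X ↔ φ ∉ X
  | conj φ ψ => conj φ ψ ∈ X ↔ φ ∈ X ∧ ψ ∈ X
  | next φ => next φ ∈ X ↔ φ ∈ Y
  | untl φ ψ => untl φ ψ ∈ X ↔ ψ ∈ X ∨ (φ ∈ X ∧ untl φ ψ ∈ Y)

/-- Unfulfilled until obligations. -/
def unf {PP : Type} (X : Finset (LTLF PP)) : Finset (LTLF PP) :=
  X.filter (fun χ => ∃ φ ψ, χ = untl φ ψ ∧ ψ ∉ X)

/-- Breakpoint update. -/
def upd {PP : Type} (B Y : Finset (LTLF PP)) : Finset (LTLF PP) :=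
  if B = ∅ then unf Y else B ∩ unf Y

theorem upd_subset {PP : Type} (B Y : Finset (LTLF PP)) : upd B Y ⊆ unf Y := by
  unfold upd; split_ifs
  · rfl
  · exact Finset.inter_subset_right

theorem unf_subset {PP : Type} (Y : Finset (LTLF PP)) : unf Y ⊆ Y := Finset.filter_subset _ _

theorem until_unfold {PP : Type} (w : ℕ → Set PP) (k : ℕ) (φ ψ : LTLF PP) :
    LTLSat w k (untl φ ψ) ↔
      LTLSat w k ψ ∨ (LTLSat w k φ ∧ LTLSat w (k + 1) (untl φ ψ)) := by
  simp only [LTLSat]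
  constructor
  · rintro ⟨j, hj, h1, h2⟩
    rcases Nat.eq_or_lt_of_le hj with rfl | hlt
    · exact Or.inl h1
    · exact Or.inr ⟨h2 k le_rfl hlt, j, hlt, h1, fun l hl hl' => h2 l (by omega) hl'⟩
  · rintro (h | ⟨h, j, hj, h1, h2⟩)
    · exact ⟨k, le_rfl, h, fun l _ _ => by omega⟩
    · refine ⟨j, by omega, h1, fun l hl hl' => ?_⟩
      rcases Nat.eq_or_lt_of_le hl with rfl | hlt
      · exact h
      · exact h2 l hlt hl'

theorem sound {PP : Type} (w : ℕ → Set PP) (S : Finset (LTLF PP)) (T B : ℕ → Finset (LTLF PP))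
    (hS : ∀ χ ∈ S, sub χ ⊆ S)
    (hloc : ∀ k, ∀ χ ∈ S, Loc (T k) (w k) (T (k + 1)) χ)
    (hB : ∀ k, B (k + 1) = upd (B k) (T (k + 1)))
    (hinf : ∀ n, ∃ m, n ≤ m ∧ B m = ∅) (χ : LTLF PP) :
    χ ∈ S → ∀ k, (χ ∈ T k ↔ LTLSat w k χ) := by
  induction χ with
  | atom p => intro h k; exact hloc k _ h
  | neg φ ih =>
    intro h k
    have h1 := ih (hS _ h (by simp [sub, self_mem])) k
    have h2 := hloc k _ h
    simp only [Loc, LTLSat] at h2 ⊢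
    rw [h2, h1]
  | next φ ih =>
    intro h k
    have h1 := ih (hS _ h (by simp [sub, self_mem])) (k + 1)
    have h2 := hloc k _ h
    simp only [Loc, LTLSat] at h2 ⊢
    rw [h2, h1]
  | conj φ ψ ih1 ih2 =>
    intro h k
    have h1 := ih1 (hS _ h (by simp [sub, self_mem])) k
    have h3 := ih2 (hS _ h (by simp [sub, self_mem])) k
    have h2 := hloc k _ h
    simp only [Loc, LTLSat] at h2 ⊢
    rw [h2, h1, h3]
  | untl φ ψ ih1 ih2 =>
    intro h k
    have h1 := ih1 (hS _ h (by simp [sub, self_mem]))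
    have h3 := ih2 (hS _ h (by simp [sub, self_mem]))
    have h2 : ∀ k, untl φ ψ ∈ T k ↔ ψ ∈ T k ∨ (φ ∈ T k ∧ untl φ ψ ∈ T (k + 1)) :=
      fun k => hloc k _ h
    constructor
    · intro hk
      by_contra hn
      have key : ∀ d, untl φ ψ ∈ T (k + d) ∧ ¬ LTLSat w (k + d) (untl φ ψ) := by
        intro d
        induction d with
        | zero => exact ⟨hk, hn⟩
        | succ d ihd =>
          obtain ⟨ha, hb⟩ := ihd
          rw [until_unfold, ← h1, ← h3] at hb
          rw [h2] at ha
          rw [← Nat.add_assoc]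
          tauto
      have hun : ∀ d, untl φ ψ ∈ unf (T (k + d)) := by
        intro d
        refine Finset.mem_filter.2 ⟨(key d).1, φ, ψ, rfl, fun hc => (key d).2 ?_⟩
        rw [until_unfold, ← h3]
        exact Or.inl hc
      obtain ⟨m, hm, hm0⟩ := hinf k
      have hall : ∀ d, untl φ ψ ∈ B (m + 1 + d) := by
        intro d
        have hu : ∀ e, untl φ ψ ∈ unf (T (m + e)) := by
          intro e
          have := hun (m - k + e)
          rwa [show k + (m - k + e) = m + e by omega] at this
        induction d with
        | zero => 
          rw [Nat.add_zero, hB, upd, if_pos hm0]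
          exact hu 1
        | succ d ihd =>
          rw [← Nat.add_assoc, hB, upd, if_neg (Finset.ne_empty_of_mem ihd)]
          refine Finset.mem_inter.2 ⟨ihd, ?_⟩
          have := hu (1 + d + 1)
          rwa [show m + (1 + d + 1) = m + 1 + d + 1 by omega] at this
      obtain ⟨m', hm', hm0'⟩ := hinf (m + 1)
      have := hall (m' - (m + 1))
      rw [show m + 1 + (m' - (m + 1)) = m' by omega, hm0'] at this
      simp at this
    · simp only [LTLSat]
      rintro ⟨j, hj, hj1, hj2⟩
      obtain ⟨d, rfl⟩ := Nat.exists_eq_add_of_le hj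
      clear hj
      induction d generalizing k with
      | zero => rw [h2]; exact Or.inl ((h3 _).2 hj1)
      | succ d ihd =>
        rw [h2]
        refine Or.inr ⟨(h1 _).2 (hj2 k le_rfl (by omega)), ihd (k + 1) ?_ ?_⟩
        · rwa [show k + 1 + d = k + (d + 1) by omega]
        · intro l hl hl'
          exact hj2 l (by omega) (by omega)

/-- Canonical truth sets. -/
def canT {PP : Type} (w : ℕ → Set PP) (S : Finset (LTLF PP)) (k : ℕ) : Finset (LTLF PP) :=
  S.filter (fun χ => LTLSat w k χ)

/-- Canonical breakpoint sets. -/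
def canB {PP : Type} (w : ℕ → Set PP) (S : Finset (LTLF PP)) : ℕ → Finset (LTLF PP)
  | 0 => ∅
  | k + 1 => upd (canB w S k) (canT w S (k + 1))

theorem canB_sub {PP : Type} (w : ℕ → Set PP) (S : Finset (LTLF PP)) (k : ℕ) :
    canB w S k ⊆ unf (canT w S k) := by
  cases k with
  | zero => exact Finset.empty_subset _
  | succ k => exact upd_subset _ _

theorem canB_inf {PP : Type} (w : ℕ → Set PP) (S : Finset (LTLF PP))
    (hS : ∀ χ ∈ S, sub χ ⊆ S) (n : ℕ) : ∃ m, n ≤ m ∧ canB w S m = ∅ := by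
  by_contra hcon
  push Not at hcon
  have hstep : ∀ k, n ≤ k → canB w S (k + 1) ⊆ canB w S k := by
    intro k hk
    have hne : canB w S k ≠ ∅ := by
      have := hcon k hk
      first | exact this | exact Finset.nonempty_iff_ne_empty.1 this
    rw [canB, upd, if_neg hne]
    exact Finset.inter_subset_left
  have hanti : ∀ j k, n ≤ j → j ≤ k → canB w S k ⊆ canB w S j := by
    intro j k hj hk
    induction k, hk using Nat.le_induction with
    | base => rfl
    | succ k hk ih => exact (hstep k (by omega)).trans ih
  have hev : ∀ χ ∈ canB w S n, ∀ᶠ k in Filter.atTop, χ ∉ canB w S k := by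
    intro χ hχ
    obtain ⟨hT, φ, ψ, rfl, -⟩ := Finset.mem_filter.1 (canB_sub w S n hχ)
    obtain ⟨hmS, hsat⟩ := Finset.mem_filter.1 hT
    obtain ⟨j, hj, hj1, -⟩ := hsat
    rw [Filter.eventually_atTop]
    refine ⟨j, fun k hk hmem => ?_⟩
    obtain ⟨-, φ', ψ', he, hnot⟩ := Finset.mem_filter.1 (canB_sub w S j (hanti j k hj hk hmem))
    cases he
    exact hnot (Finset.mem_filter.2 ⟨hS _ hmS (by simp [sub, self_mem]), hj1⟩)
  have hev2 := (Filter.eventually_all_finset (canB w S n)).2 hev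
  obtain ⟨k, hk, hnk⟩ := (hev2.and (Filter.eventually_ge_atTop n)).exists
  have hemp : canB w S k = ∅ :=
    Finset.eq_empty_of_forall_notMem fun χ hχ => hk χ (hanti n k le_rfl hnk hχ) hχ
  have := hcon k hnk
  rw [hemp] at this
  simp at this

theorem canT_loc {PP : Type} (w : ℕ → Set PP) (S : Finset (LTLF PP))
    (hS : ∀ χ ∈ S, sub χ ⊆ S) (k : ℕ) (χ : LTLF PP) (h : χ ∈ S) :
    Loc (canT w S k) (w k) (canT w S (k + 1)) χ := by
  have hsub := hS χ h
  cases χ with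
  | atom p => simp [Loc, canT, h, LTLSat]
  | neg φ =>
    have h1 : φ ∈ S := hsub (by simp [sub, self_mem])
    simp [Loc, canT, h, h1, LTLSat]
  | next φ =>
    have h1 : φ ∈ S := hsub (by simp [sub, self_mem])
    simp [Loc, canT, h, h1, LTLSat]
  | conj φ ψ =>
    have h1 : φ ∈ S := hsub (by simp [sub, self_mem])
    have h2 : ψ ∈ S := hsub (by simp [sub, self_mem])
    simp [Loc, canT, h, h1, h2, LTLSat]
  | untl φ ψ =>
    have h1 : φ ∈ S := hsub (by simp [sub, self_mem])
    have h2 : ψ ∈ S := hsub (by simp [sub, self_mem])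
    have := until_unfold w k φ ψ
    simpa only [Loc, canT, Finset.mem_filter, h, h1, h2, true_and] using this

/-- The automaton. -/
def aut {PP : Type} (φ : LTLF PP) : NBA (Set PP) where
  Q := (sub φ).powerset × (sub φ).powerset
  start := {q | φ ∈ q.1.1}
  δ := fun q a => {r | (∀ χ ∈ sub φ, Loc q.1.1 a r.1.1 χ) ∧ r.2.1 = upd q.2.1 r.1.1}
  F := {q | q.2.1 = ∅}

theorem aut_card {PP : Type} (φ : LTLF PP) : Fintype.card (aut φ).Q ≤ 2 ^ (2 * φ.size) := by
  have h : Fintype.card (aut φ).Q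
      = Fintype.card ((sub φ).powerset × (sub φ).powerset) := Fintype.card_congr (Equiv.refl _)
  rw [h, Fintype.card_prod, Fintype.card_coe, Finset.card_powerset, ← pow_add]
  have := sub_card φ
  exact Nat.pow_le_pow_right (by norm_num) (by omega)

theorem aut_iff {PP : Type} (φ : LTLF PP) (w : ℕ → Set PP) :
    (aut φ).Accepts w ↔ LTLSat w 0 φ := by
  constructor
  · rintro ⟨ρ, h0, hs, q, hq, hinf⟩
    refine (sound w (sub φ) (fun k => (ρ k).1.1) (fun k => (ρ k).2.1) (sub_trans φ)
      (fun k => (hs k).1) (fun k => (hs k).2) (fun n => ?_) φ (self_mem φ) 0).1 h0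
    obtain ⟨m, hm, he⟩ := hinf n
    refine ⟨m, hm, ?_⟩
    simp only [he]
    exact hq
  · intro h
    have hTS : ∀ k, canT w (sub φ) k ⊆ sub φ := fun k => Finset.filter_subset _ _
    let ρ : ℕ → (aut φ).Q := fun k =>
      (⟨canT w (sub φ) k, Finset.mem_powerset.2 (hTS k)⟩,
       ⟨canB w (sub φ) k, Finset.mem_powerset.2
          (((canB_sub w _ k).trans (unf_subset _)).trans (hTS k))⟩)
    refine ⟨ρ, Finset.mem_filter.2 ⟨self_mem φ, h⟩,
      fun k => ⟨canT_loc w _ (sub_trans φ) k, rfl⟩, ?_⟩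
    have hfr : ∃ᶠ m in Filter.atTop, ∃ q : (aut φ).Q, q ∈ (aut φ).F ∧ ρ m = q := by
      rw [Filter.frequently_atTop]
      intro n
      obtain ⟨m, hm, he⟩ := canB_inf w (sub φ) (sub_trans φ) n
      exact ⟨m, hm, ρ m, he, rfl⟩
    by_contra hcon
    push Not at hcon
    have hall : ∀ q : (aut φ).Q, ∀ᶠ m in Filter.atTop, ¬ (q ∈ (aut φ).F ∧ ρ m = q) := by
      intro q
      by_cases hq : q ∈ (aut φ).F
      · obtain ⟨n, hn⟩ := hcon q hq
        exact Filter.eventually_atTop.2 ⟨n, fun m hm hc => hn m hm hc.2⟩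
      · exact Filter.Eventually.of_forall fun m hc => hq hc.1
    have hall2 := Filter.eventually_all.2 hall
    obtain ⟨m, ⟨q, hq⟩, hm⟩ := (hfr.and_eventually hall2).exists
    exact hm q hq

end

end LTLAux

/-- **Theorem (Vardi–Wolper).** There is a constant c such that every LTL formula φ over
a finite set of atomic propositions can be translated into a nondeterministic Büchi
automaton over the alphabet 2^Prop with at most 2^{c·|φ|} states whose language is
exactly the set of computations satisfying φ. -/
theorem stmt6 : ∃ c : ℕ, ∀ (PP : Type) [Fintype PP] (φ : LTLF PP),
    ∃ A : NBA (Set PP), Fintype.card A.Q ≤ 2 ^ (c * φ.size) ∧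
      ∀ w : ℕ → Set PP, A.Accepts w ↔ LTLSat w 0 φ := by
  exact ⟨2, fun PP _ φ => ⟨LTLAux.aut φ, LTLAux.aut_card φ, LTLAux.aut_iff φ⟩⟩
end

section
/- The following are equivalent: (1) for some tuple A = ⟨A_1,…,A_n⟩ of finite-state automata, the joint protocol P_A realizes φ ∧ Know(Φ,A) in E; (2) the formula φ ∧ Say(Φ) is realizable in E' by a joint protocol represented by finite-state automata. -/
/-! Multi-agent framework: formulas of the logic of knowledge and branching time with
both perfect-recall knowledge operators K_i and automaton-based operators K_i^A,
environments for n agents, runs, joint protocols, protocol automata, satisfaction. -/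

/-- Formulae: atomic propositions, ¬, ∧, ○, U, ∃, K_i and K_i^A. -/
inductive MFml (n : ℕ) (PP : Type) : Type
  | tru : MFml n PP
  | atom : PP → MFml n PP
  | neg : MFml n PP → MFml n PP
  | conj : MFml n PP → MFml n PP → MFml n PP
  | next : MFml n PP → MFml n PP
  | untl : MFml n PP → MFml n PP → MFml n PP
  | exis : MFml n PP → MFml n PP
  | know : Fin n → MFml n PP → MFml n PP
  | knowA : Fin n → MFml n PP → MFml n PP
  deriving DecidableEq

namespace MFml
variable {n : ℕ} {PP PP' : Type}

/-- The list of subformulae. -/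
def subf : MFml n PP → List (MFml n PP)
  | tru => [tru]
  | atom p => [atom p]
  | neg φ => neg φ :: φ.subf
  | conj φ ψ => conj φ ψ :: (φ.subf ++ ψ.subf)
  | next φ => next φ :: φ.subf
  | untl φ ψ => untl φ ψ :: (φ.subf ++ ψ.subf)
  | exis φ => exis φ :: φ.subf
  | know i φ => know i φ :: φ.subf
  | knowA i φ => knowA i φ :: φ.subf

/-- The formula contains no automaton-knowledge operator K_i^A, i.e. it is a formula of
the logic of knowledge and branching time. -/
def noA : MFml n PP → Prop
  | tru => True
  | atom _ => True
  | neg φ => φ.noA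
  | conj φ ψ => φ.noA ∧ ψ.noA
  | next φ => φ.noA
  | untl φ ψ => φ.noA ∧ ψ.noA
  | exis φ => φ.noA
  | know _ φ => φ.noA
  | knowA _ _ => False

/-- Renaming of atomic propositions. -/
def pmap (f : PP → PP') : MFml n PP → MFml n PP'
  | tru => tru
  | atom p => atom (f p)
  | neg φ => neg (φ.pmap f)
  | conj φ ψ => conj (φ.pmap f) (ψ.pmap f)
  | next φ => next (φ.pmap f)
  | untl φ ψ => untl (φ.pmap f) (ψ.pmap f)
  | exis φ => exis (φ.pmap f)
  | know i φ => know i (φ.pmap f)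
  | knowA i φ => knowA i (φ.pmap f)

/-- Implication φ ⇒ ψ, i.e. ¬(φ ∧ ¬ψ). -/
def imp (φ ψ : MFml n PP) : MFml n PP := neg (conj φ (neg ψ))

/-- Equivalence φ ≡ ψ. -/
def iff' (φ ψ : MFml n PP) : MFml n PP := conj (imp φ ψ) (imp ψ φ)

/-- Disjunction φ ∨ ψ, i.e. ¬(¬φ ∧ ¬ψ). -/
def disj (φ ψ : MFml n PP) : MFml n PP := neg (conj (neg φ) (neg ψ))

/-- □φ, i.e. ¬(true U ¬φ). -/
def box (φ : MFml n PP) : MFml n PP := neg (untl tru (neg φ))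

/-- ∀φ, i.e. ¬∃¬φ. -/
def fall (φ : MFml n PP) : MFml n PP := neg (exis (neg φ))

/-- Finite conjunction. -/
def bigConj (l : List (MFml n PP)) : MFml n PP := l.foldr conj tru

end MFml

/-- An automaton representing an agent's protocol: protocol states, initial state,
transition function on observations, and action function. -/
structure PAut (O A : Type) : Type 1 where
  Q : Type
  q0 : Q
  mu : Q → O → Q
  act : Q → Set A

namespace PAut
variable {O A : Type}

/-- The state `A(σ)` reached after reading the input sequence σ. -/
def run (M : PAut O A) (σ : List O) : M.Q := σ.foldl M.mu M.q0

/-- The protocol `P_A` represented by the automaton. -/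
def prot (M : PAut O A) (σ : List O) : Set A := M.act (M.run σ)

end PAut

/-- The trivial one-state automaton (used where the automaton component of the
semantics is irrelevant). -/
def unitAut (O A : Type) : PAut O A :=
  ⟨PUnit, PUnit.unit, fun _ _ => PUnit.unit, fun _ => Set.univ⟩

/-- A (finite, when the state type is finite) interpreted environment for n agents. -/
structure MEnv (n : ℕ) (S ACTe : Type) (ACT : Fin n → Type) (O PP : Type) where
  initSt : Set S
  Pe : S → Set ACTe
  Pe_ne : ∀ s, (Pe s).Nonempty
  tr : ACTe × ((i : Fin n) → ACT i) → S → S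
  obs : Fin n → S → O
  val : S → PP → Bool

namespace MEnv
variable {n : ℕ} {S ACTe : Type} {ACT : Fin n → Type} {O PP : Type}

/-- Synchronous perfect-recall local state `r_i(m) = O_i(r 0) … O_i(r m)`. -/
def locSt (E : MEnv n S ACTe ACT O PP) (i : Fin n) (r : ℕ → S) (m : ℕ) : List O :=
  (List.range (m + 1)).map fun k => E.obs i (r k)

/-- The runs of the system generated by the joint protocol `P` in `E`. -/
def IsRun (E : MEnv n S ACTe ACT O PP) (P : (i : Fin n) → List O → Set (ACT i))
    (r : ℕ → S) : Prop :=
  r 0 ∈ E.initSt ∧ ∀ m, ∃ a : ACTe × ((i : Fin n) → ACT i),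
    a.1 ∈ E.Pe (r m) ∧ (∀ i, a.2 i ∈ P i (E.locSt i r m)) ∧ r (m + 1) = E.tr a (r m)

/-- Satisfaction `ℐ(P,E),(r,m) ⊨ φ`; the operators `K_i^A` are interpreted via the
indistinguishability relation ≈_i^A induced by the automata `Au`. -/
def msat (E : MEnv n S ACTe ACT O PP) (P : (i : Fin n) → List O → Set (ACT i))
    (Au : (i : Fin n) → PAut O (ACT i)) : (ℕ → S) → ℕ → MFml n PP → Prop
  | _, _, .tru => True
  | r, m, .atom p => E.val (r m) p = true
  | r, m, .neg φ => ¬ E.msat P Au r m φ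
  | r, m, .conj φ ψ => E.msat P Au r m φ ∧ E.msat P Au r m ψ
  | r, m, .next φ => E.msat P Au r (m + 1) φ
  | r, m, .untl φ ψ =>
      ∃ k, m ≤ k ∧ E.msat P Au r k ψ ∧ ∀ l, m ≤ l → l < k → E.msat P Au r l φ
  | r, m, .exis φ => ∃ r', E.IsRun P r' ∧ (∀ k, k ≤ m → r' k = r k) ∧ E.msat P Au r' m φ
  | r, m, .know i φ => ∀ r' m', E.IsRun P r' →
      E.locSt i r' m' = E.locSt i r m → E.msat P Au r' m' φ
  | r, m, .knowA i φ => ∀ r' m', E.IsRun P r' →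
      (Au i).run (E.locSt i r' m') = (Au i).run (E.locSt i r m) → E.msat P Au r' m' φ

/-- The joint protocol `P` realizes ψ in `E`. -/
def MRealizes (E : MEnv n S ACTe ACT O PP) (P : (i : Fin n) → List O → Set (ACT i))
    (Au : (i : Fin n) → PAut O (ACT i)) (ψ : MFml n PP) : Prop :=
  ∀ r, E.IsRun P r → E.msat P Au r 0 ψ

end MEnv

/-- The joint protocol `P_A` represented by a tuple of automata. -/
def autProt {n : ℕ} {O : Type} {ACT : Fin n → Type} (Au : (i : Fin n) → PAut O (ACT i)) :
    (i : Fin n) → List O → Set (ACT i) := fun i => (Au i).prot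

/-- Formula said_i(ψ) holds via the new atomic proposition indexed by (i, ψ). -/
abbrev SaidProp (n : ℕ) (PP : Type) : Type := PP ⊕ (Fin n × MFml n PP)

/-- The modified environment E' in which each agent's actions additionally assert a set
of knowledge formulas, the states record the latest assertions, and the new atomic
propositions said_i(ψ) report them. -/
def extEnv {n : ℕ} {S ACTe : Type} {ACT : Fin n → Type} {O PP : Type} [DecidableEq PP]
    (E : MEnv n S ACTe ACT O PP) :
    MEnv n (S × (Fin n → Finset (MFml n PP))) ACTe
      (fun i => ACT i × Finset (MFml n PP)) O (SaidProp n PP) where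
  initSt := {x | x.1 ∈ E.initSt ∧ ∀ i, x.2 i = ∅}
  Pe := fun x => E.Pe x.1
  Pe_ne := fun x => E.Pe_ne x.1
  tr := fun a x => (E.tr (a.1, fun i => (a.2 i).1) x.1, fun i => (a.2 i).2)
  obs := fun i x => E.obs i x.1
  val := fun x p => match p with
    | Sum.inl q => E.val x.1 q
    | Sum.inr iψ => decide (iψ.2 ∈ x.2 iψ.1)

/-- The conjunct of Say(Φ) for a member K_iψ of Φ:  □(K_iψ ≡ ○ said_i(K_iψ)). -/
def sayOne {n : ℕ} {PP : Type} : MFml n PP → MFml n (SaidProp n PP)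
  | .know i ψ => MFml.box (MFml.iff' ((MFml.know i ψ).pmap Sum.inl)
      (MFml.next (MFml.atom (Sum.inr (i, MFml.know i ψ)))))
  | _ => .tru

/-- Say(Φ) = ⋀_{K_iψ ∈ Φ} □(K_iψ ≡ ○ said_i(K_iψ)): agents say what they know
(according to perfect recall). -/
def sayF {n : ℕ} {PP : Type} (Φ : List (MFml n PP)) : MFml n (SaidProp n PP) :=
  MFml.bigConj (Φ.map sayOne)

/-- The conjunct of Know(Φ,A) for a member K_iψ of Φ:  □(K_iψ ≡ K_i^A ψ). -/
def knowOne {n : ℕ} {PP : Type} : MFml n PP → MFml n PP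
  | .know i ψ => MFml.box (MFml.iff' (MFml.know i ψ) (MFml.knowA i ψ))
  | _ => .tru

/-- Know(Φ,A) = ⋀_{K_iψ ∈ Φ} □(K_iψ ≡ K_i^A ψ): each agent knows a fact in Φ according
to its protocol automaton just when it knows it using perfect recall. -/
def knowEq {n : ℕ} {PP : Type} (Φ : List (MFml n PP)) : MFml n PP :=
  MFml.bigConj (Φ.map knowOne)


namespace Stmt13Aux
open MEnv
variable {n : ℕ} {S ACTe : Type} {ACT : Fin n → Type} {O PP : Type}

theorem msat_box (E : MEnv n S ACTe ACT O PP) (P : (i : Fin n) → List O → Set (ACT i))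
    (Au : (i : Fin n) → PAut O (ACT i)) (r : ℕ → S) (χ : MFml n PP) :
    E.msat P Au r 0 (MFml.box χ) ↔ ∀ k, E.msat P Au r k χ := by
  simp [MFml.box, msat]

theorem msat_iff (E : MEnv n S ACTe ACT O PP) (P : (i : Fin n) → List O → Set (ACT i))
    (Au : (i : Fin n) → PAut O (ACT i)) (r : ℕ → S) (m : ℕ) (χ χ' : MFml n PP) :
    E.msat P Au r m (MFml.iff' χ χ') ↔ (E.msat P Au r m χ ↔ E.msat P Au r m χ') := by
  simp only [MFml.iff', MFml.imp, msat]
  tauto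

theorem msat_bigConj (E : MEnv n S ACTe ACT O PP) (P : (i : Fin n) → List O → Set (ACT i))
    (Au : (i : Fin n) → PAut O (ACT i)) (r : ℕ → S) (m : ℕ) (l : List (MFml n PP)) :
    E.msat P Au r m (MFml.bigConj l) ↔ ∀ χ ∈ l, E.msat P Au r m χ := by
  induction l with
  | nil => simp [MFml.bigConj, msat]
  | cons a l ih =>
    have : MFml.bigConj (a :: l) = MFml.conj a (MFml.bigConj l) := rfl
    rw [this]
    simp [msat, ih]

theorem locSt_congr (E : MEnv n S ACTe ACT O PP) (i : Fin n) (r r' : ℕ → S) (m : ℕ)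
    (h : ∀ k, k ≤ m → r k = r' k) : E.locSt i r m = E.locSt i r' m := by
  unfold locSt
  apply List.map_congr_left
  intro k hk
  rw [h k (by simpa [Nat.lt_succ_iff] using hk)]

theorem run_succ (E : MEnv n S ACTe ACT O PP) (i : Fin n) (M : PAut O (ACT i)) (r : ℕ → S)
    (m : ℕ) : M.run (E.locSt i r (m + 1)) = M.mu (M.run (E.locSt i r m)) (E.obs i (r (m + 1))) := by
  unfold locSt PAut.run
  rw [List.range_succ (n := m + 1), List.map_append, List.foldl_append]
  rfl

/-- Any finite prefix of a run together with an admissible joint action extends to a run. -/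
theorem extend (E : MEnv n S ACTe ACT O PP) (Au : (i : Fin n) → PAut O (ACT i))
    (hne : ∀ i q, ((Au i).act q).Nonempty) (r : ℕ → S) (hr : E.IsRun (autProt Au) r) (m : ℕ)
    (a : ACTe × ((i : Fin n) → ACT i)) (ha : a.1 ∈ E.Pe (r m))
    (ha2 : ∀ i, a.2 i ∈ autProt Au i (E.locSt i r m)) :
    ∃ r', E.IsRun (autProt Au) r' ∧ (∀ k, k ≤ m → r' k = r k) ∧ r' (m + 1) = E.tr a (r m) := by
  choose ae hae using E.Pe_ne
  choose aa haa using hne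
  let c : ℕ → S × ((i : Fin n) → (Au i).Q) := fun k => Nat.rec
    (E.tr a (r m), fun i => (Au i).mu ((Au i).run (E.locSt i r m)) (E.obs i (E.tr a (r m))))
    (fun _ x => (E.tr (ae x.1, fun i => aa i (x.2 i)) x.1,
      fun i => (Au i).mu (x.2 i) (E.obs i (E.tr (ae x.1, fun i => aa i (x.2 i)) x.1)))) k
  let r' : ℕ → S := fun k => if k ≤ m then r k else (c (k - (m + 1))).1
  have h1 : ∀ k, k ≤ m → r' k = r k := fun k hk => by simp [r', hk]
  have h2 : ∀ k, r' (m + 1 + k) = (c k).1 := fun k => by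
    have : ¬ (m + 1 + k ≤ m) := by omega
    simp [r', this]
  have h3 : ∀ k i, (Au i).run (E.locSt i r' (m + 1 + k)) = (c k).2 i := by
    intro k i
    induction k with
    | zero =>
      rw [Nat.add_zero, run_succ, locSt_congr E i r' r m h1, show m + 1 = m + 1 + 0 from rfl, h2 0]
      rfl
    | succ k ih =>
      rw [show m + 1 + (k + 1) = (m + 1 + k) + 1 from rfl, run_succ, ih,
        show (m + 1 + k) + 1 = m + 1 + (k + 1) from rfl, h2 (k + 1)]
  refine ⟨r', ⟨?_, ?_⟩, h1, ?_⟩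
  · rw [h1 0 (Nat.zero_le _)]; exact hr.1
  · intro k
    rcases lt_trichotomy k m with hk | hk | hk
    · obtain ⟨b, hb1, hb2, hb3⟩ := hr.2 k
      refine ⟨b, ?_, ?_, ?_⟩
      · rw [h1 k hk.le]; exact hb1
      · intro i
        rw [locSt_congr E i r' r k (fun j hj => h1 j (by omega))]; exact hb2 i
      · rw [h1 (k + 1) hk, h1 k hk.le]; exact hb3
    · subst hk
      refine ⟨a, ?_, ?_, ?_⟩
      · rw [h1 k le_rfl]; exact ha
      · intro i
        rw [locSt_congr E i r' r k h1]; exact ha2 i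
      · rw [h1 k le_rfl]; exact h2 0
    · obtain ⟨j, rfl⟩ : ∃ j, k = m + 1 + j := ⟨k - (m + 1), by omega⟩
      refine ⟨(ae (c j).1, fun i => aa i ((c j).2 i)), ?_, ?_, ?_⟩
      · rw [h2]; exact hae _
      · intro i
        change _ ∈ (Au i).act ((Au i).run (E.locSt i r' (m + 1 + j)))
        rw [h3]; exact haa _ _
      · rw [h2 j]; exact h2 (j + 1)
  · exact h2 0

variable [DecidableEq PP]

theorem proj_run (E : MEnv n S ACTe ACT O PP) (P : (i : Fin n) → List O → Set (ACT i))
    (P' : (i : Fin n) → List O → Set (ACT i × Finset (MFml n PP)))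
    (hP : ∀ i σ a, a ∈ P i σ ↔ ∃ Ψ, (a, Ψ) ∈ P' i σ)
    (r : ℕ → S × (Fin n → Finset (MFml n PP))) (hr : (extEnv E).IsRun P' r) :
    E.IsRun P (fun k => (r k).1) := by
  refine ⟨hr.1.1, fun m => ?_⟩
  obtain ⟨a, h1, h2, h3⟩ := hr.2 m
  refine ⟨(a.1, fun i => (a.2 i).1), h1, fun i => (hP _ _ _).2 ⟨(a.2 i).2, h2 i⟩, ?_⟩
  exact congrArg Prod.fst h3

theorem lift_run (E : MEnv n S ACTe ACT O PP) (P : (i : Fin n) → List O → Set (ACT i))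
    (P' : (i : Fin n) → List O → Set (ACT i × Finset (MFml n PP)))
    (hP : ∀ i σ a, a ∈ P i σ ↔ ∃ Ψ, (a, Ψ) ∈ P' i σ)
    (r : ℕ → S) (hr : E.IsRun P r) (m : ℕ) (r0 : ℕ → S × (Fin n → Finset (MFml n PP)))
    (h0 : ∀ i, (r0 0).2 i = ∅)
    (hstep : ∀ k, k < m → ∃ a : ACTe × ((i : Fin n) → ACT i × Finset (MFml n PP)),
      a.1 ∈ (extEnv E).Pe (r0 k) ∧ (∀ i, a.2 i ∈ P' i ((extEnv E).locSt i r0 k)) ∧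
        r0 (k + 1) = (extEnv E).tr a (r0 k))
    (hag : ∀ k, k ≤ m → r k = (r0 k).1) :
    ∃ r', (extEnv E).IsRun P' r' ∧ (∀ k, k ≤ m → r' k = r0 k) ∧ (fun k => (r' k).1) = r := by
  choose a ha1 ha2 ha3 using hr.2
  have : ∀ k i, ∃ Ψ, ((a k).2 i, Ψ) ∈ P' i (E.locSt i r k) := fun k i => (hP _ _ _).1 (ha2 k i)
  choose Ψ hΨ using this
  let r' : ℕ → S × (Fin n → Finset (MFml n PP)) :=
    fun k => (r k, if k ≤ m then (r0 k).2 else Ψ (k - 1))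
  have h1 : ∀ k, k ≤ m → r' k = r0 k := fun k hk => by
    simp only [r', hk, if_true, hag k hk]
  refine ⟨r', ⟨⟨hr.1, ?_⟩, ?_⟩, h1, rfl⟩
  · intro i
    rw [h1 0 (Nat.zero_le _)]; exact h0 i
  · intro k
    by_cases hk : k < m
    · obtain ⟨b, hb1, hb2, hb3⟩ := hstep k hk
      refine ⟨b, ?_, ?_, ?_⟩
      · rw [h1 k hk.le]; exact hb1
      · intro i
        rw [locSt_congr _ i r' r0 k (fun j hj => h1 j (by omega))]; exact hb2 i
      · rw [h1 (k + 1) hk, h1 k hk.le]; exact hb3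
    · refine ⟨((a k).1, fun i => ((a k).2 i, Ψ k i)), ha1 k, fun i => hΨ k i, ?_⟩
      have : ¬ (k + 1 ≤ m) := by omega
      simp only [r', this, if_false, extEnv, Nat.add_sub_cancel]
      rw [ha3 k]

theorem lift_run0 (E : MEnv n S ACTe ACT O PP) (P : (i : Fin n) → List O → Set (ACT i))
    (P' : (i : Fin n) → List O → Set (ACT i × Finset (MFml n PP)))
    (hP : ∀ i σ a, a ∈ P i σ ↔ ∃ Ψ, (a, Ψ) ∈ P' i σ)
    (r : ℕ → S) (hr : E.IsRun P r) :
    ∃ r', (extEnv E).IsRun P' r' ∧ (fun k => (r' k).1) = r := by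
  obtain ⟨r', h, -, h'⟩ := lift_run E P P' hP r hr 0 (fun k => (r k, fun _ => ∅)) (fun _ => rfl)
    (fun k hk => absurd hk (Nat.not_lt_zero _)) (fun _ _ => rfl)
  exact ⟨r', h, h'⟩

theorem msat_proj (E : MEnv n S ACTe ACT O PP) (P : (i : Fin n) → List O → Set (ACT i))
    (P' : (i : Fin n) → List O → Set (ACT i × Finset (MFml n PP)))
    (hP : ∀ i σ a, a ∈ P i σ ↔ ∃ Ψ, (a, Ψ) ∈ P' i σ)
    (Au : (i : Fin n) → PAut O (ACT i))
    (Au' : (i : Fin n) → PAut O (ACT i × Finset (MFml n PP)))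
    (χ : MFml n PP) (hχ : χ.noA) :
    ∀ r, (extEnv E).IsRun P' r → ∀ m,
      ((extEnv E).msat P' Au' r m (χ.pmap Sum.inl) ↔ E.msat P Au (fun k => (r k).1) m χ) := by
  induction χ with
  | tru => intro r hr m; simp [MFml.pmap, msat]
  | atom p => intro r hr m; simp [MFml.pmap, msat, extEnv]
  | neg χ ih => intro r hr m; simp only [MFml.pmap, msat, ih hχ r hr m]
  | conj χ χ' ih ih' =>
    intro r hr m; simp only [MFml.pmap, msat, ih hχ.1 r hr m, ih' hχ.2 r hr m]
  | next χ ih => intro r hr m; simp only [MFml.pmap, msat, ih hχ r hr]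
  | untl χ χ' ih ih' =>
    intro r hr m; simp only [MFml.pmap, msat, ih hχ.1 r hr, ih' hχ.2 r hr]
  | exis χ ih =>
    intro r hr m
    simp only [MFml.pmap, msat]
    constructor
    · rintro ⟨r', h1, h2, h3⟩
      exact ⟨fun k => (r' k).1, proj_run E P P' hP r' h1, fun k hk => by simp only [h2 k hk],
        (ih hχ r' h1 m).1 h3⟩
    · rintro ⟨r2, h1, h2, h3⟩
      obtain ⟨r', h4, h5, rfl⟩ := lift_run E P P' hP r2 h1 m r hr.1.2 (fun k _ => hr.2 k) h2
      exact ⟨r', h4, h5, (ih hχ r' h4 m).2 h3⟩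
  | know i χ ih =>
    intro r hr m
    simp only [MFml.pmap, msat]
    constructor
    · intro h r2 m' h1 h2
      obtain ⟨r', h4, rfl⟩ := lift_run0 E P P' hP r2 h1
      exact (ih hχ r' h4 m').1 (h r' m' h4 h2)
    · intro h r' m' h1 h2
      exact (ih hχ r' h1 m').2 (h _ m' (proj_run E P P' hP r' h1) h2)
  | knowA i χ ih => exact hχ.elim

theorem realizes_know (E : MEnv n S ACTe ACT O PP) (P : (i : Fin n) → List O → Set (ACT i))
    (Au : (i : Fin n) → PAut O (ACT i)) (Φ : List (MFml n PP))
    (hΦ : ∀ χ ∈ Φ, ∃ (i : Fin n) (ψ : MFml n PP), χ = MFml.know i ψ ∧ ψ.noA) (r : ℕ → S) :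
    E.msat P Au r 0 (knowEq Φ) ↔ ∀ i ψ, MFml.know i ψ ∈ Φ → ∀ k,
      (E.msat P Au r k (.know i ψ) ↔ E.msat P Au r k (.knowA i ψ)) := by
  unfold knowEq
  rw [msat_bigConj]
  simp only [List.mem_map, forall_exists_index, and_imp, forall_apply_eq_imp_iff₂]
  constructor
  · intro h i ψ hi k
    have := h _ hi
    simp only [knowOne, msat_box, msat_iff] at this
    exact this k
  · intro h χ hχ
    obtain ⟨i, ψ, rfl, -⟩ := hΦ χ hχ
    simp only [knowOne, msat_box, msat_iff]
    exact h i ψ hχ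

theorem realizes_say (E : MEnv n S ACTe ACT O PP)
    (P : (i : Fin n) → List O → Set (ACT i × Finset (MFml n PP)))
    (Au : (i : Fin n) → PAut O (ACT i × Finset (MFml n PP))) (Φ : List (MFml n PP))
    (hΦ : ∀ χ ∈ Φ, ∃ (i : Fin n) (ψ : MFml n PP), χ = MFml.know i ψ ∧ ψ.noA)
    (r : ℕ → S × (Fin n → Finset (MFml n PP))) :
    (extEnv E).msat P Au r 0 (sayF Φ) ↔ ∀ i ψ, MFml.know i ψ ∈ Φ → ∀ k,
      ((extEnv E).msat P Au r k ((MFml.know i ψ).pmap Sum.inl) ↔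
        MFml.know i ψ ∈ (r (k + 1)).2 i) := by
  have key : ∀ i ψ k, (extEnv E).msat P Au r k
      (MFml.next (MFml.atom (Sum.inr (i, MFml.know i ψ)))) ↔
        MFml.know i ψ ∈ (r (k + 1)).2 i := by
    intro i ψ k
    simp [msat, extEnv]
  unfold sayF
  rw [msat_bigConj]
  simp only [List.mem_map, forall_exists_index, and_imp, forall_apply_eq_imp_iff₂]
  constructor
  · intro h i ψ hi k
    have := h _ hi
    simp only [sayOne, msat_box, msat_iff, key] at this
    exact this k
  · intro h χ hχ
    obtain ⟨i, ψ, rfl, -⟩ := hΦ χ hχ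
    simp only [sayOne, msat_box, msat_iff, key]
    exact h i ψ hχ

end Stmt13Aux

open Stmt13Aux MEnv in
/-- **Proposition.** The following are equivalent: (1) for some tuple A of finite-state
automata, the joint protocol P_A realizes φ ∧ Know(Φ,A) in E; (2) φ ∧ Say(Φ) is
realizable in E' by a joint protocol represented by finite-state automata. -/
theorem stmt13 {n : ℕ} {S ACTe : Type} {ACT : Fin n → Type} {O PP : Type}
    [DecidableEq PP] (E : MEnv n S ACTe ACT O PP) (φ : MFml n PP) (hφ : φ.noA)
    (Φ : List (MFml n PP))
    (hΦ : ∀ χ ∈ Φ, ∃ (i : Fin n) (ψ : MFml n PP), χ = MFml.know i ψ ∧ ψ.noA)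
    (hcl : ∀ χ ∈ Φ, ∀ χ' ∈ χ.subf, (∃ (i : Fin n) (ψ : MFml n PP), χ' = MFml.know i ψ) →
      χ' ∈ Φ) :
    (∃ Au : (i : Fin n) → PAut O (ACT i), (∀ i, Finite (Au i).Q) ∧
      (∀ i q, ((Au i).act q).Nonempty) ∧
      E.MRealizes (autProt Au) Au (MFml.conj φ (knowEq Φ))) ↔
    (∃ Au' : (i : Fin n) → PAut O (ACT i × Finset (MFml n PP)),
      (∀ i, Finite (Au' i).Q) ∧ (∀ i q, ((Au' i).act q).Nonempty) ∧
      (extEnv E).MRealizes (autProt Au') Au'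
        (MFml.conj (φ.pmap Sum.inl) (sayF Φ))) := by
  classical
  constructor
  · rintro ⟨Au, hfin, hne, hreal⟩
    let Kn : (i : Fin n) → (Au i).Q → Finset (MFml n PP) := fun i q =>
      Φ.toFinset.filter (fun χ => ∃ ψ, χ = MFml.know i ψ ∧ ∀ r m, E.IsRun (autProt Au) r →
        (Au i).run (E.locSt i r m) = q → E.msat (autProt Au) Au r m ψ)
    let Au' : (i : Fin n) → PAut O (ACT i × Finset (MFml n PP)) := fun i =>
      ⟨(Au i).Q, (Au i).q0, (Au i).mu, fun q => {x | x.1 ∈ (Au i).act q ∧ x.2 = Kn i q}⟩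
    have hrun : ∀ i σ, (Au' i).run σ = (Au i).run σ := fun i σ => rfl
    have hP : ∀ i σ a, a ∈ autProt Au i σ ↔ ∃ Ψ, (a, Ψ) ∈ autProt Au' i σ := by
      intro i σ a
      constructor
      · intro h
        exact ⟨Kn i ((Au i).run σ), h, rfl⟩
      · rintro ⟨Ψ, h, -⟩
        exact h
    refine ⟨Au', hfin, ?_, ?_⟩
    · intro i q
      obtain ⟨a, ha⟩ := hne i q
      exact ⟨(a, Kn i q), ha, rfl⟩
    · intro r hr
      have hpr := proj_run E _ _ hP r hr
      obtain ⟨h1, h2⟩ := hreal _ hpr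
      rw [realizes_know E _ _ Φ hΦ] at h2
      refine ⟨(msat_proj E _ _ hP Au Au' φ hφ r hr 0).2 h1, ?_⟩
      rw [realizes_say E _ _ Φ hΦ]
      intro i ψ hi k
      have hno : ψ.noA := by
        obtain ⟨j, ψ', h, h'⟩ := hΦ _ hi
        cases h; exact h'
      rw [msat_proj E _ _ hP Au Au' (MFml.know i ψ) hno r hr k, h2 i ψ hi k]
      obtain ⟨a, -, ha2, ha3⟩ := hr.2 k
      have hK : (r (k + 1)).2 i = Kn i ((Au i).run (E.locSt i (fun k => (r k).1) k)) := by
        rw [ha3]; exact (ha2 i).2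
      rw [hK]
      simp only [Kn, Finset.mem_filter, List.mem_toFinset, hi, true_and, msat]
      constructor
      · intro h
        exact ⟨ψ, rfl, h⟩
      · rintro ⟨ψ', h, h'⟩
        cases h; exact h'
  · rintro ⟨Au', hfin, hne, hreal⟩
    let Au : (i : Fin n) → PAut O (ACT i) := fun i =>
      ⟨(Au' i).Q, (Au' i).q0, (Au' i).mu, fun q => {a | ∃ Ψ, (a, Ψ) ∈ (Au' i).act q}⟩
    have hP : ∀ i σ a, a ∈ autProt Au i σ ↔ ∃ Ψ, (a, Ψ) ∈ autProt Au' i σ := fun i σ a => Iff.rfl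
    refine ⟨Au, hfin, ?_, ?_⟩
    · intro i q
      obtain ⟨⟨a, Ψ⟩, ha⟩ := hne i q
      exact ⟨a, Ψ, ha⟩
    · intro r0 hr0
      obtain ⟨r, hr, rfl⟩ := lift_run0 E _ _ hP r0 hr0
      have hsay : ∀ r, (extEnv E).IsRun (autProt Au') r → _ := fun r hr =>
        (realizes_say E _ _ Φ hΦ r).1 (hreal r hr).2
      refine ⟨(msat_proj E _ _ hP Au Au' φ hφ r hr 0).1 (hreal r hr).1, ?_⟩
      rw [realizes_know E _ _ Φ hΦ]
      intro i ψ hi k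
      have hno : ψ.noA := by
        obtain ⟨j, ψ', h, h'⟩ := hΦ _ hi
        cases h; exact h'
      constructor
      · intro hk r2 m2 hr2 heq
        obtain ⟨r2', hr2', rfl⟩ := lift_run0 E _ _ hP r2 hr2
        have hs := (hsay r hr i ψ hi k).1
          ((msat_proj E _ _ hP Au Au' (MFml.know i ψ) hno r hr k).2 hk)
        obtain ⟨a, -, ha2, ha3⟩ := hr.2 k
        obtain ⟨b, hb1, hb2, hb3⟩ := hr2'.2 m2
        have hst : (Au' i).run ((extEnv E).locSt i r2' m2) =
          (Au' i).run ((extEnv E).locSt i r k) := heq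
        obtain ⟨r3, h31, h32, h33⟩ := extend (extEnv E) Au' hne r2' hr2' m2
          (b.1, Function.update b.2 i (a.2 i)) hb1 (by
            intro j
            by_cases hj : j = i
            · subst hj
              have := ha2 j
              simp only [Function.update_self]
              change _ ∈ (Au' j).act _
              rw [hst]; exact this
            · simp only [Function.update_of_ne hj]
              exact hb2 j)
        have hs3 : MFml.know i ψ ∈ (r3 (m2 + 1)).2 i := by
          rw [h33]
          rw [ha3] at hs
          simpa [extEnv] using hs
        have hk3 := (msat_proj E _ _ hP Au Au' (MFml.know i ψ) hno r3 h31 m2).1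
          ((hsay r3 h31 i ψ hi m2).2 hs3)
        exact hk3 _ m2 hr2 (locSt_congr (extEnv E) i r2' r3 m2 (fun k hk => (h32 k hk).symm))
      · intro h r' m' h1 h2
        exact h r' m' h1 (by rw [h2])
end

section
/- In the toggle environment with initial states I_e = {⟨1,0⟩, ⟨1,1⟩} (toggle on, light on or off), the protocol P for agent 1 with P(v) = {T} for every v ∈ 𝒪⁺ realizes the specification □(K_1 toggle-on ∨ K_1 ¬toggle-on) under the synchronous perfect-recall semantics of knowledge. -/
/-! The timed toggle switch environment of Example 1. -/

/-- Agent 1's actions: toggle (T) and the null action (Λ). -/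
inductive TogAct : Type
  | tog : TogAct
  | nop : TogAct
  deriving DecidableEq

/-- States ⟨t,l⟩ with t the toggle position and l the light, subject to l ≤ t
(the light can only be on when the toggle is on). -/
abbrev TogSt : Type := {p : Bool × Bool // p.2 ≤ p.1}

/-- Transition function: the toggle flips if the agent toggles or (being on) the
environment times it out; the light is on iff the toggle is on and the environment
switches it on. -/
def togTr (a : (Bool × Bool) × (Fin 1 → TogAct)) (s : TogSt) : TogSt :=
  let t := s.val.1
  let t' := if a.2 0 = TogAct.tog ∨ (t = true ∧ a.1.1 = true) then !t else t
  ⟨(t', t' && a.1.2), by cases t' <;> cases a.1.2 <;> simp⟩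

/-- The toggle environment, with a parameter for the set of initial states: one agent,
environment actions (u,v) (timeout, light-on), observation = the light, and the single
atomic proposition toggle-on. -/
def togEnv (I : Set TogSt) : MEnv 1 TogSt (Bool × Bool) (fun _ => TogAct) Bool Unit where
  initSt := I
  Pe := fun _ => Set.univ
  Pe_ne := fun _ => ⟨(true, true), Set.mem_univ _⟩
  tr := togTr
  obs := fun _ s => s.val.2
  val := fun s _ => s.val.1

/-- The atomic proposition toggle-on. -/
def tOn : MFml 1 Unit := MFml.atom ()

/-- The specification □(K₁ toggle-on ∨ K₁ ¬toggle-on). -/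
def togSpec : MFml 1 Unit :=
  MFml.box (MFml.disj (MFml.know 0 tOn) (MFml.know 0 (MFml.neg tOn)))

/-- Along every run of the always-toggle protocol, the toggle position is determined by
the parity of the time. -/
theorem tog_parity (r : ℕ → TogSt)
    (hr : (togEnv {s | s.val.1 = true}).IsRun (fun _ _ => ({TogAct.tog} : Set TogAct)) r)
    (m : ℕ) : (r m).val.1 = decide (m % 2 = 0) := by
  induction m with
  | zero => exact (show (r 0).val.1 = true from hr.1)
  | succ k ih =>
    obtain ⟨a, -, h2, h3⟩ := hr.2 k
    have h0 : a.2 0 = TogAct.tog := h2 0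
    have h4 : (r (k + 1)).val.1 = !(r k).val.1 := by
      rw [h3]
      simp [togEnv, togTr, h0]
    rw [h4, ih]
    rcases Nat.mod_two_eq_zero_or_one k with h | h
    · have : (k + 1) % 2 = 1 := by omega
      simp [h, this]
    · have : (k + 1) % 2 = 0 := by omega
      simp [h, this]

/-- **Example.** In the toggle environment with initial states {⟨1,0⟩,⟨1,1⟩} (toggle on),
the protocol that always toggles realizes □(K₁ toggle-on ∨ K₁ ¬toggle-on) under the
synchronous perfect-recall semantics of knowledge. -/
theorem stmt16 :
    (togEnv {s | s.val.1 = true}).MRealizes (fun _ _ => ({TogAct.tog} : Set TogAct))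
      (fun _ => unitAut Bool TogAct) togSpec := by
  intro r hr
  rintro ⟨k, -, hk, -⟩
  apply hk
  rintro ⟨h1, h2⟩
  have hlen : ∀ (r' : ℕ → TogSt) (m' : ℕ),
      (togEnv {s | s.val.1 = true}).locSt 0 r' m' =
        (togEnv {s | s.val.1 = true}).locSt 0 r k → m' = k := by
    intro r' m' h
    have := congrArg List.length h
    simpa [MEnv.locSt] using this
  rcases Nat.mod_two_eq_zero_or_one k with hp | hp
  · apply h1
    intro r' m' hr' hl
    obtain rfl := hlen r' m' hl
    have := tog_parity r' hr' m'
    change (r' m').val.1 = true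
    simp [this, hp]
  · apply h2
    intro r' m' hr' hl
    obtain rfl := hlen r' m' hl
    have := tog_parity r' hr' m'
    change ¬ (r' m').val.1 = true
    simp [this, hp]
end
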